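/- arXiv:2110.02786 — 9 statements merged into one kernel-verified Lean document; each statement's English description precedes it below -/
import Mathlib

section
/- For every ordinal α and every set A of ordinals with A ⊆ α: if A belongs to every normal measure on α, then the set {β < α : A ∩ β belongs to every normal measure on β} belongs to every normal measure on α. (Equivalently, A ∈ M_α implies {β < α : A ∩ β ∈ M_β} ∈ M_α; this is the key step in Blass's soundness theorem for GL over the normal-measure filter sequence.) -/
/-- A normal measure on an ordinal `η`: an ultrafilter on the set of ordinals below `η`
(coded as a family of subsets of `Set.Iio η`) which is nonprincipal, `η`-complete and
normal (closed under diagonal intersections). -/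
structure IsNormalMeasure (η : Ordinal) (U : Set (Set Ordinal)) : Prop where
  subset_iio : ∀ X ∈ U, X ⊆ Set.Iio η
  univ_mem : Set.Iio η ∈ U
  superset_mem : ∀ X ∈ U, ∀ Y ⊆ Set.Iio η, X ⊆ Y → Y ∈ U
  inter_mem : ∀ X ∈ U, ∀ Y ∈ U, X ∩ Y ∈ U
  empty_not_mem : ∅ ∉ U
  ultra : ∀ X ⊆ Set.Iio η, X ∈ U ∨ (Set.Iio η \ X) ∈ U
  nonprincipal : ∀ α : Ordinal, {α} ∉ U
  complete : ∀ θ < η, ∀ A : Ordinal → Set Ordinal, (∀ ξ < θ, A ξ ∈ U) →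
      (Set.Iio η ∩ ⋂ ξ ∈ Set.Iio θ, A ξ) ∈ U
  normal : ∀ A : Ordinal → Set Ordinal, (∀ ξ < η, A ξ ∈ U) →
      {α | α < η ∧ ∀ ξ < α, α ∈ A ξ} ∈ U

/-- `MSet η` is the collection of all subsets of `η` belonging to every normal measure on `η`. -/
def MSet (η : Ordinal) : Set (Set Ordinal) :=
  {X | X ⊆ Set.Iio η ∧ ∀ U, IsNormalMeasure η U → X ∈ U}

/-- `g` witnesses `W ◁ U` (combinatorial Mitchell order) on `η`. -/
def MitchellWitness (η : Ordinal) (g : Ordinal → Set (Set Ordinal))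
    (W U : Set (Set Ordinal)) : Prop :=
  {ν | ν < η ∧ IsNormalMeasure ν (g ν)} ∈ U ∧
  W = {X | X ⊆ Set.Iio η ∧ {ν | ν < η ∧ X ∩ Set.Iio ν ∈ g ν} ∈ U}

/-- The combinatorial Mitchell order. -/
def MitchellLt (η : Ordinal) (W U : Set (Set Ordinal)) : Prop :=
  ∃ g, MitchellWitness η g W U

/-- The `U`-limit of a family `g ν` of normal measures on `ν` is a normal measure. -/
theorem isNormalMeasure_limit (α : Ordinal) (U : Set (Set Ordinal)) (hU : IsNormalMeasure α U)
    (g : Ordinal → Set (Set Ordinal)) (B : Set Ordinal) (hB : B ∈ U)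
    (hg : ∀ ν ∈ B, IsNormalMeasure ν (g ν)) :
    IsNormalMeasure α {X | X ⊆ Set.Iio α ∧ {ν | ν < α ∧ X ∩ Set.Iio ν ∈ g ν} ∈ U} := by
  have key : ∀ Y ∈ U, ∀ X : Set Ordinal, (∀ ν ∈ Y, ν ∈ B → ν < α → X ∩ Set.Iio ν ∈ g ν) →
      {ν | ν < α ∧ X ∩ Set.Iio ν ∈ g ν} ∈ U := by
    intro Y hY X hX
    refine hU.superset_mem _ (hU.inter_mem _ hY _ hB) _ (fun ν hν => hν.1) ?_
    intro ν hν
    have hlt : ν < α := hU.subset_iio _ hB hν.2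
    exact ⟨hlt, hX ν hν.1 hν.2 hlt⟩
  have nokey : ∀ X : Set Ordinal, (∀ ν ∈ B, X ∩ Set.Iio ν ∉ g ν) →
      {ν | ν < α ∧ X ∩ Set.Iio ν ∈ g ν} ∉ U := by
    intro X hX hmem
    apply hU.empty_not_mem
    have h1 := hU.inter_mem _ hmem _ hB
    have h2 : {ν | ν < α ∧ X ∩ Set.Iio ν ∈ g ν} ∩ B = ∅ := by
      ext ν
      simp only [Set.mem_inter_iff, Set.mem_empty_iff_false, iff_false]
      exact fun hν => hX ν hν.2 hν.1.2
    rwa [h2] at h1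
  refine ⟨fun X hX => hX.1, ⟨subset_rfl, ?_⟩, ?_, ?_, ?_, ?_, ?_, ?_, ?_⟩
  · refine key _ hB _ fun ν _ hν hlt => ?_
    have : Set.Iio α ∩ Set.Iio ν = Set.Iio ν :=
      Set.inter_eq_right.2 (Set.Iio_subset_Iio hlt.le)
    rw [this]; exact (hg ν hν).univ_mem
  · intro X hX Y hY hXY
    refine ⟨hY, key _ hX.2 _ fun ν h1 hν _ => ?_⟩
    exact (hg ν hν).superset_mem _ h1.2 _ Set.inter_subset_right
      (Set.inter_subset_inter_left _ hXY)
  · intro X hX Y hY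
    refine ⟨Set.inter_subset_left.trans hX.1,
      key _ (hU.inter_mem _ hX.2 _ hY.2) _ fun ν h1 hν _ => ?_⟩
    rw [Set.inter_inter_distrib_right]
    exact (hg ν hν).inter_mem _ h1.1.2 _ h1.2.2
  · intro h
    refine nokey ∅ (fun ν hν => ?_) h.2
    rw [Set.empty_inter]; exact (hg ν hν).empty_not_mem
  · intro X hX
    rcases hU.ultra {ν | ν < α ∧ X ∩ Set.Iio ν ∈ g ν} (fun ν hν => hν.1) with h | h
    · exact Or.inl ⟨hX, h⟩
    · refine Or.inr ⟨Set.diff_subset, key _ h _ fun ν h1 hν hlt => ?_⟩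
      rcases (hg ν hν).ultra (X ∩ Set.Iio ν) Set.inter_subset_right with h2 | h2
      · exact absurd ⟨hlt, h2⟩ h1.2
      · refine (hg ν hν).superset_mem _ h2 _ Set.inter_subset_right ?_
        rintro β ⟨hβ, hβ'⟩
        exact ⟨⟨lt_trans hβ hlt, fun hx => hβ' ⟨hx, hβ⟩⟩, hβ⟩
  · intro γ h
    refine nokey {γ} (fun ν hν hmem => ?_) h.2
    exact (hg ν hν).nonprincipal γ
      ((hg ν hν).superset_mem _ hmem _ (by
        rintro β rfl
        by_contra hβ
        apply (hg ν hν).empty_not_mem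
        have : ({β} ∩ Set.Iio ν : Set Ordinal) = ∅ := by
          ext x
          simp only [Set.mem_inter_iff, Set.mem_singleton_iff, Set.mem_empty_iff_false, iff_false]
          rintro ⟨rfl, hx⟩
          exact hβ hx
        rwa [this] at hmem) Set.inter_subset_left)
  · intro θ hθ A hA
    refine ⟨Set.inter_subset_left, ?_⟩
    have hne : ∀ ξ, Set.Iio α \ {ξ} ∈ U := by
      intro ξ
      by_cases hξ : ξ < α
      · rcases hU.ultra {ξ} (by rintro _ rfl; exact hξ) with h | h
        · exact absurd h (hU.nonprincipal ξ)
        · exact h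
      · refine hU.superset_mem _ hU.univ_mem _ Set.diff_subset ?_
        intro β hβ
        refine ⟨hβ, ?_⟩
        rintro rfl
        exact hξ hβ
    have h1 := hU.complete θ hθ (fun ξ => Set.Iio α \ {ξ}) (fun ξ _ => hne ξ)
    have h2 := hU.complete θ hθ (fun ξ => {ν | ν < α ∧ A ξ ∩ Set.Iio ν ∈ g ν})
      (fun ξ hξ => (hA ξ hξ).2)
    refine key _ (hU.inter_mem _ (hU.inter_mem _ h1 _ (hne θ)) _ h2) _ fun ν hν hνB hlt => ?_
    obtain ⟨⟨⟨_, ha⟩, hb⟩, ⟨_, hc⟩⟩ := hν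
    simp only [Set.mem_iInter, Set.mem_Iio] at ha hc
    have hθν : θ < ν := by
      refine lt_of_le_of_ne (not_lt.1 fun hlt' => (ha ν hlt').2 rfl) ?_
      rintro rfl
      exact hb.2 rfl
    refine (hg ν hνB).superset_mem _ ((hg ν hνB).complete θ hθν (fun ξ => A ξ ∩ Set.Iio ν)
      (fun ξ hξ => (hc ξ hξ).2)) _ Set.inter_subset_right ?_
    rintro β ⟨hβ, hβ'⟩
    simp only [Set.mem_iInter, Set.mem_Iio] at hβ'
    refine ⟨⟨lt_trans hβ hlt, ?_⟩, hβ⟩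
    simp only [Set.mem_iInter, Set.mem_Iio]
    exact fun ξ hξ => (hβ' ξ hξ).1
  · intro A hA
    refine ⟨fun β hβ => hβ.1, ?_⟩
    have h2 := hU.normal (fun ξ => {ν | ν < α ∧ A ξ ∩ Set.Iio ν ∈ g ν})
      (fun ξ hξ => (hA ξ hξ).2)
    refine key _ h2 _ fun ν hν hνB hlt => ?_
    refine (hg ν hνB).superset_mem _ ((hg ν hνB).normal (fun ξ => A ξ ∩ Set.Iio ν)
      (fun ξ hξ => (hν.2 ξ hξ).2)) _ Set.inter_subset_right ?_
    rintro β ⟨hβ, hβ'⟩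
    exact ⟨⟨lt_trans hβ hlt, fun ξ hξ => (hβ' ξ hξ).1⟩, hβ⟩

/-- Blass's key soundness step: if `A ⊆ α` belongs to every normal measure on `α`
(i.e. `A ∈ M_α`), then `{β < α : A ∩ β ∈ M_β}` belongs to every normal measure on `α`. -/
theorem mset_reflection (α : Ordinal) (A : Set Ordinal) (hA : A ⊆ Set.Iio α)
    (h : A ∈ MSet α) :
    {β | β < α ∧ A ∩ Set.Iio β ∈ MSet β} ∈ MSet α := by
  classical
  refine ⟨fun β hβ => hβ.1, fun U hU => ?_⟩
  rcases hU.ultra {β | β < α ∧ A ∩ Set.Iio β ∈ MSet β} (fun β hβ => hβ.1) with h1 | hB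
  · exact h1
  exfalso
  have hex : ∀ ν, ∃ V : Set (Set Ordinal),
      ν ∈ Set.Iio α \ {β | β < α ∧ A ∩ Set.Iio β ∈ MSet β} →
        IsNormalMeasure ν V ∧ A ∩ Set.Iio ν ∉ V := by
    intro ν
    by_cases hν : ν ∈ Set.Iio α \ {β | β < α ∧ A ∩ Set.Iio β ∈ MSet β}
    · by_contra hcon
      refine hν.2 ⟨hν.1, Set.inter_subset_right, fun V hV => ?_⟩
      by_contra hn
      exact hcon ⟨V, fun _ => ⟨hV, hn⟩⟩
    · exact ⟨∅, fun h => absurd h hν⟩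
  choose g hg using hex
  have hW := h.2 _ (isNormalMeasure_limit α U hU g _ hB fun ν hν => (hg ν hν).1)
  have h3 := hU.inter_mem _ hW.2 _ hB
  refine hU.empty_not_mem ?_
  convert h3
  symm
  ext ν
  simp only [Set.mem_inter_iff, Set.mem_empty_iff_false, iff_false]
  exact fun hν => (hg ν hν.2).2 hν.1.2
end

section
/- Every ordinal κ that carries at least one normal measure carries a normal measure U such that the set {α < κ : there is no normal measure on α} belongs to U. (Any measurable cardinal has a normal measure containing the set of non-measurable ordinals below it.) -/
theorem IsNormalMeasure.mono_sep {κ : Ordinal} {U : Set (Set Ordinal)} (hU : IsNormalMeasure κ U)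
    {T : Set Ordinal} (hT : T ∈ U) {P : Ordinal → Prop} (h : ∀ ν ∈ T, P ν) :
    {ν | ν < κ ∧ P ν} ∈ U :=
  hU.superset_mem T hT _ (fun _ hx => hx.1) (fun x hx => ⟨hU.subset_iio T hT hx, h x hx⟩)

theorem IsNormalMeasure.nonempty_mem {κ : Ordinal} {U : Set (Set Ordinal)}
    (hU : IsNormalMeasure κ U) {T : Set Ordinal} (hT : T ∈ U) : ∃ ν, ν ∈ T := by
  by_contra hne
  have : T = ∅ := Set.eq_empty_iff_forall_notMem.2 (fun x hx => hne ⟨x, hx⟩)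
  exact hU.empty_not_mem (this ▸ hT)

theorem IsNormalMeasure.ne_mem {κ : Ordinal} {U : Set (Set Ordinal)} (hU : IsNormalMeasure κ U)
    {θ : Ordinal} (hθ : θ < κ) : Set.Iio κ \ {θ} ∈ U := by
  rcases hU.ultra {θ} (by intro x hx; rw [Set.mem_singleton_iff.1 hx]; exact hθ) with h | h
  · exact absurd h (hU.nonprincipal θ)
  · exact h

theorem IsNormalMeasure.gt_mem {κ : Ordinal} {U : Set (Set Ordinal)} (hU : IsNormalMeasure κ U)
    {θ : Ordinal} (hθ : θ < κ) : {ν | ν < κ ∧ θ < ν} ∈ U := by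
  have h1 := hU.complete θ hθ (fun ξ => Set.Iio κ \ {ξ}) (fun ξ hξ => hU.ne_mem (hξ.trans hθ))
  refine hU.mono_sep (hU.inter_mem _ h1 _ (hU.ne_mem hθ)) ?_
  rintro ν ⟨⟨_, h2⟩, h3⟩
  by_contra hlt
  rcases lt_or_eq_of_le (not_lt.1 hlt) with h4 | h4
  · have := Set.mem_iInter₂.1 h2 ν h4
    exact this.2 rfl
  · exact h3.2 h4

theorem IsNormalMeasure.limit {κ : Ordinal} {U : Set (Set Ordinal)} (hU : IsNormalMeasure κ U)
    (g : Ordinal → Set (Set Ordinal)) (hM : {ν | ν < κ ∧ IsNormalMeasure ν (g ν)} ∈ U) :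
    IsNormalMeasure κ {X | X ⊆ Set.Iio κ ∧ {ν | ν < κ ∧ X ∩ Set.Iio ν ∈ g ν} ∈ U} where
  subset_iio X hX := hX.1
  univ_mem := by
    refine ⟨subset_rfl, hU.mono_sep hM ?_⟩
    rintro ν ⟨hν, hg⟩
    rw [Set.inter_eq_right.2 (Set.Iio_subset_Iio hν.le)]
    exact hg.univ_mem
  superset_mem := by
    rintro X ⟨_, hX⟩ Y hY hXY
    refine ⟨hY, hU.mono_sep (hU.inter_mem _ hM _ hX) ?_⟩
    rintro ν ⟨⟨hν, hg⟩, _, h⟩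
    exact hg.superset_mem _ h _ Set.inter_subset_right (Set.inter_subset_inter_left _ hXY)
  inter_mem := by
    rintro X ⟨hX', hX⟩ Y ⟨_, hY⟩
    refine ⟨Set.inter_subset_left.trans hX',
      hU.mono_sep (hU.inter_mem _ hM _ (hU.inter_mem _ hX _ hY)) ?_⟩
    rintro ν ⟨⟨hν, hg⟩, ⟨_, h⟩, _, h'⟩
    rw [Set.inter_inter_distrib_right]
    exact hg.inter_mem _ h _ h'
  empty_not_mem := by
    rintro ⟨_, h⟩
    obtain ⟨ν, ⟨_, hg⟩, _, h'⟩ := hU.nonempty_mem (hU.inter_mem _ hM _ h)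
    rw [Set.empty_inter] at h'
    exact hg.empty_not_mem h'
  ultra := by
    intro X hX
    rcases hU.ultra {ν | ν < κ ∧ X ∩ Set.Iio ν ∈ g ν} (fun _ h => h.1) with h | h
    · exact Or.inl ⟨hX, h⟩
    · refine Or.inr ⟨Set.diff_subset, hU.mono_sep (hU.inter_mem _ hM _ h) ?_⟩
      rintro ν ⟨⟨hν, hg⟩, _, h'⟩
      rcases hg.ultra (X ∩ Set.Iio ν) Set.inter_subset_right with h2 | h2
      · exact absurd ⟨hν, h2⟩ h'
      · refine hg.superset_mem _ h2 _ Set.inter_subset_right ?_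
        rintro x ⟨hx, hx'⟩
        exact ⟨⟨lt_trans hx hν, fun h => hx' ⟨h, hx⟩⟩, hx⟩
  nonprincipal := by
    rintro β ⟨_, h⟩
    obtain ⟨ν, ⟨_, hg⟩, _, h'⟩ := hU.nonempty_mem (hU.inter_mem _ hM _ h)
    by_cases hβ : β < ν
    · rw [Set.inter_eq_left.2 (by intro x hx; rw [Set.mem_singleton_iff.1 hx]; exact hβ)] at h'
      exact hg.nonprincipal β h'
    · obtain ⟨x, hx, hx'⟩ := hg.nonempty_mem h'
      rw [Set.mem_singleton_iff.1 hx] at hx'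
      exact hβ hx'
  complete := by
    intro θ hθ A hA
    refine ⟨Set.inter_subset_left, ?_⟩
    have h1 := hU.complete θ hθ (fun ξ => {ν | ν < κ ∧ A ξ ∩ Set.Iio ν ∈ g ν})
      (fun ξ hξ => (hA ξ hξ).2)
    refine hU.mono_sep (hU.inter_mem _ hM _ (hU.inter_mem _ h1 _ (hU.gt_mem hθ))) ?_
    rintro ν ⟨⟨hν, hg⟩, ⟨_, h2⟩, _, h3⟩
    have h4 := hg.complete θ h3 (fun ξ => A ξ ∩ Set.Iio ν)
      (fun ξ hξ => (Set.mem_iInter₂.1 h2 ξ hξ).2)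
    refine hg.superset_mem _ h4 _ Set.inter_subset_right ?_
    rintro x ⟨hx, hx'⟩
    exact ⟨⟨lt_trans hx hν, Set.mem_iInter₂.2 fun ξ hξ => (Set.mem_iInter₂.1 hx' ξ hξ).1⟩, hx⟩
  normal := by
    intro A hA
    refine ⟨fun _ h => h.1, ?_⟩
    have h1 := hU.normal (fun ξ => {ν | ν < κ ∧ A ξ ∩ Set.Iio ν ∈ g ν})
      (fun ξ hξ => (hA ξ hξ).2)
    refine hU.mono_sep (hU.inter_mem _ hM _ h1) ?_
    rintro ν ⟨⟨hν, hg⟩, _, h2⟩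
    have h4 := hg.normal (fun ξ => A ξ ∩ Set.Iio ν) (fun ξ hξ => (h2 ξ hξ).2)
    refine hg.superset_mem _ h4 _ Set.inter_subset_right ?_
    rintro x ⟨hx, hx'⟩
    exact ⟨⟨lt_trans hx hν, fun ξ hξ => (hx' ξ hξ).1⟩, hx⟩

/-- Every ordinal carrying a normal measure carries one concentrating on the
non-measurable ordinals below it. -/
theorem measure_on_nonmeasurables (κ : Ordinal) (h : ∃ U, IsNormalMeasure κ U) :
    ∃ U, IsNormalMeasure κ U ∧
      {α | α < κ ∧ ¬ ∃ W, IsNormalMeasure α W} ∈ U := by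
  induction κ using WellFoundedLT.induction with
  | ind κ ih =>
  obtain ⟨U, hU⟩ := h
  rcases hU.ultra {α | α < κ ∧ ¬ ∃ W, IsNormalMeasure α W} (fun _ h => h.1) with hN | hN
  · exact ⟨U, hU, hN⟩
  have key : ∀ α, ∃ W, α < κ → (∃ W, IsNormalMeasure α W) → (IsNormalMeasure α W ∧
      {β | β < α ∧ ¬ ∃ W, IsNormalMeasure β W} ∈ W) := by
    intro α
    by_cases hα : α < κ ∧ ∃ W, IsNormalMeasure α W
    · obtain ⟨W, hW⟩ := ih α hα.1 hα.2
      exact ⟨W, fun _ _ => hW⟩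
    · exact ⟨∅, fun h1 h2 => absurd ⟨h1, h2⟩ hα⟩
  choose g hg using key
  have hm : ∀ ν ∈ Set.Iio κ \ {α | α < κ ∧ ¬ ∃ W, IsNormalMeasure α W},
      ν < κ ∧ IsNormalMeasure ν (g ν) ∧ {β | β < ν ∧ ¬ ∃ W, IsNormalMeasure β W} ∈ g ν := by
    rintro ν ⟨hν, h2⟩
    refine ⟨hν, hg ν hν ?_⟩
    by_contra h3
    exact h2 ⟨hν, h3⟩
  refine ⟨_, hU.limit g (hU.mono_sep hN fun ν hν => (hm ν hν).2.1), fun _ h => h.1,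
    hU.mono_sep hN fun ν hν => ?_⟩
  obtain ⟨h1, h2, h3⟩ := hm ν hν
  refine h2.superset_mem _ h3 _ Set.inter_subset_right ?_
  rintro x ⟨hx, hx'⟩
  exact ⟨⟨lt_trans hx h1, hx'⟩, hx⟩
end

section
/- Let U be a normal measure on an ordinal η and let g be a function assigning to each ν < η a family g(ν) of subsets of ν, such that {ν < η : g(ν) is a normal measure on ν} ∈ U. Then W := {X ⊆ η : {ν < η : X ∩ ν ∈ g(ν)} ∈ U} is a normal measure on η (and hence W ◁ U, witnessed by g). -/
theorem IsNormalMeasure.tail_mem {η : Ordinal} {U : Set (Set Ordinal)}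
    (hU : IsNormalMeasure η U) (θ : Ordinal) (hθ : θ < η) :
    {ν | ν < η ∧ θ < ν} ∈ U := by
  have h1 : ∀ ξ, ξ < η → Set.Iio η \ {ξ} ∈ U := fun ξ hξ =>
    (hU.ultra {ξ} (by simpa using hξ)).resolve_left (hU.nonprincipal ξ)
  have h2 := hU.complete θ hθ (fun ξ => Set.Iio η \ {ξ}) (fun ξ hξ => h1 ξ (hξ.trans hθ))
  refine hU.superset_mem _ (hU.inter_mem _ h2 _ (h1 θ hθ)) _ (fun ν hν => hν.1) ?_
  rintro ν ⟨⟨hν, hI⟩, hνθ⟩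
  refine ⟨hν, lt_of_not_ge fun hle => ?_⟩
  rcases hle.lt_or_eq with h | h
  · have := Set.mem_iInter₂.1 hI ν h
    exact this.2 rfl
  · exact hνθ.2 h

/-- If `U` is a normal measure on `η` and `g ν` is a normal measure on `ν` for
`U`-almost all `ν < η`, then `W = {X ⊆ η : {ν < η : X ∩ ν ∈ g ν} ∈ U}` is a normal
measure on `η`, and `g` witnesses `W ◁ U`. -/
theorem witness_yields_normal_measure (η : Ordinal) (U : Set (Set Ordinal))
    (hU : IsNormalMeasure η U) (g : Ordinal → Set (Set Ordinal))
    (hg : {ν | ν < η ∧ IsNormalMeasure ν (g ν)} ∈ U) :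
    IsNormalMeasure η {X | X ⊆ Set.Iio η ∧ {ν | ν < η ∧ X ∩ Set.Iio ν ∈ g ν} ∈ U} ∧
    MitchellWitness η g
      {X | X ⊆ Set.Iio η ∧ {ν | ν < η ∧ X ∩ Set.Iio ν ∈ g ν} ∈ U} U := by
  refine ⟨?_, hg, rfl⟩
  have key : ∀ T ∈ U, ∀ X : Set Ordinal,
      (∀ ν ∈ T, ν < η → IsNormalMeasure ν (g ν) → X ∩ Set.Iio ν ∈ g ν) →
      {ν | ν < η ∧ X ∩ Set.Iio ν ∈ g ν} ∈ U := fun T hT X h =>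
    hU.superset_mem _ (hU.inter_mem _ hT _ hg) _ (fun ν hν => hν.1)
      (fun ν hν => ⟨hν.2.1, h ν hν.1 hν.2.1 hν.2.2⟩)
  have key2 : ∀ T ∈ U, (∀ ν ∈ T, ν < η → IsNormalMeasure ν (g ν) → False) → False := by
    intro T hT h
    refine hU.empty_not_mem ?_
    exact hU.superset_mem _ (hU.inter_mem _ hT _ hg) _ (Set.empty_subset _)
      (fun ν hν => (h ν hν.1 hν.2.1 hν.2.2).elim)
  refine ⟨fun X hX => hX.1, ⟨subset_rfl, ?_⟩, ?_, ?_, ?_, ?_, ?_, ?_, ?_⟩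
  · refine key _ hU.univ_mem _ fun ν _ hν hm => ?_
    rw [Set.inter_eq_right.2 (Set.Iio_subset_Iio hν.le)]
    exact hm.univ_mem
  · rintro X ⟨_, hX⟩ Y hY hXY
    exact ⟨hY, key _ hX _ fun ν hν _ hm => hm.superset_mem _ hν.2 _ Set.inter_subset_right
      (Set.inter_subset_inter_left _ hXY)⟩
  · rintro X ⟨hX1, hX⟩ Y ⟨_, hY⟩
    refine ⟨fun a ha => hX1 ha.1, key _ (hU.inter_mem _ hX _ hY) _ fun ν hν _ hm => ?_⟩
    rw [Set.inter_inter_distrib_right]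
    exact hm.inter_mem _ hν.1.2 _ hν.2.2
  · rintro ⟨_, h⟩
    refine key2 _ h fun ν hν _ hm => hm.empty_not_mem ?_
    simpa using hν.2
  · intro X hX
    rcases hU.ultra {ν | ν < η ∧ X ∩ Set.Iio ν ∈ g ν} (fun ν hν => hν.1) with h | h
    · exact Or.inl ⟨hX, h⟩
    · refine Or.inr ⟨Set.sdiff_subset, key _ h _ fun ν hν hνη hm => ?_⟩
      rcases hm.ultra (X ∩ Set.Iio ν) Set.inter_subset_right with h' | h'
      · exact absurd ⟨hνη, h'⟩ hν.2
      · refine hm.superset_mem _ h' _ Set.inter_subset_right ?_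
        rintro a ⟨ha, hn⟩
        exact ⟨⟨lt_trans ha hνη, fun hx => hn ⟨hx, ha⟩⟩, ha⟩
  · rintro α ⟨_, h⟩
    refine key2 _ h fun ν hν _ hm => hm.nonprincipal α ?_
    by_cases hα : α < ν
    · have := hν.2
      rwa [Set.inter_eq_left.2 (by simpa using hα)] at this
    · refine absurd ?_ hm.empty_not_mem
      have := hν.2
      rwa [Set.singleton_inter_eq_empty.2 (by simpa using hα)] at this
  · intro θ hθ A hA
    refine ⟨Set.inter_subset_left, ?_⟩
    have h1 := hU.complete θ hθ _ (fun ξ hξ => (hA ξ hξ).2)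
    refine key _ (hU.inter_mem _ h1 _ (hU.tail_mem θ hθ)) _ fun ν hν hνη hm => ?_
    have h2 := hm.complete θ hν.2.2 (fun ξ => A ξ ∩ Set.Iio ν)
      (fun ξ hξ => (Set.mem_iInter₂.1 hν.1.2 ξ hξ).2)
    refine hm.superset_mem _ h2 _ Set.inter_subset_right ?_
    rintro a ⟨ha, hI⟩
    exact ⟨⟨lt_trans ha hνη, Set.mem_iInter₂.2 fun ξ hξ => (Set.mem_iInter₂.1 hI ξ hξ).1⟩, ha⟩
  · intro A hA
    refine ⟨fun a ha => ha.1, ?_⟩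
    have h1 := hU.normal _ (fun ξ hξ => (hA ξ hξ).2)
    refine key _ h1 _ fun ν hν hνη hm => ?_
    have h2 := hm.normal (fun ξ => A ξ ∩ Set.Iio ν) (fun ξ hξ => (hν.2 ξ hξ).2)
    refine hm.superset_mem _ h2 _ Set.inter_subset_right ?_
    rintro a ⟨ha, hI⟩
    exact ⟨⟨lt_trans ha hνη, fun ξ hξ => (hI ξ hξ).1⟩, ha⟩
end

section
/- For every ordinal η, the combinatorial Mitchell order ◁ is a well-founded relation on the set of all normal measures on η. -/
namespace MitchellAux

universe u

theorem mem_mono {η : Ordinal.{u}} {U : Set (Set Ordinal.{u})} (hU : IsNormalMeasure η U)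
    {P Q : Ordinal.{u} → Prop} (hP : {x | x < η ∧ P x} ∈ U) (h : ∀ x < η, P x → Q x) :
    {x | x < η ∧ Q x} ∈ U :=
  hU.superset_mem _ hP _ (fun _ hx => hx.1) (fun x hx => ⟨hx.1, h x hx.1 hx.2⟩)

theorem mem_and {η : Ordinal.{u}} {U : Set (Set Ordinal.{u})} (hU : IsNormalMeasure η U)
    {P Q : Ordinal.{u} → Prop} (hP : {x | x < η ∧ P x} ∈ U) (hQ : {x | x < η ∧ Q x} ∈ U) :
    {x | x < η ∧ P x ∧ Q x} ∈ U :=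
  hU.superset_mem _ (hU.inter_mem _ hP _ hQ) _ (fun _ hx => hx.1)
    (fun _ hx => ⟨hx.1.1, hx.1.2, hx.2.2⟩)

theorem mem_exists {η : Ordinal.{u}} {U : Set (Set Ordinal.{u})} (hU : IsNormalMeasure η U)
    {P : Ordinal.{u} → Prop} (hP : {x | x < η ∧ P x} ∈ U) : ∃ x < η, P x := by
  by_contra hcon
  push Not at hcon
  apply hU.empty_not_mem
  have : {x | x < η ∧ P x} = ∅ := by
    ext x
    simpa using hcon x
  rwa [this] at hP

theorem mem_compl {η : Ordinal.{u}} {U : Set (Set Ordinal.{u})} (hU : IsNormalMeasure η U)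
    (P : Ordinal.{u} → Prop) : {x | x < η ∧ P x} ∈ U ∨ {x | x < η ∧ ¬ P x} ∈ U := by
  rcases hU.ultra {x | x < η ∧ P x} (fun _ hx => hx.1) with h | h
  · exact Or.inl h
  · right
    refine hU.superset_mem _ h _ (fun _ hx => hx.1) (fun x hx => ⟨hx.1, fun hp => hx.2 ⟨hx.1, hp⟩⟩)

theorem pos {η : Ordinal.{u}} {U : Set (Set Ordinal.{u})} (hU : IsNormalMeasure η U) :
    0 < η := by
  have h := hU.univ_mem
  rw [pos_iff_ne_zero]
  rintro rfl
  apply hU.empty_not_mem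
  convert h
  ext x
  simp

theorem mem_ne {η : Ordinal.{u}} {U : Set (Set Ordinal.{u})} (hU : IsNormalMeasure η U)
    (β : Ordinal.{u}) : {x | x < η ∧ x ≠ β} ∈ U := by
  rcases mem_compl hU (fun x => x = β) with h | h
  · exfalso
    obtain ⟨x, hx, rfl⟩ := mem_exists hU h
    apply hU.nonprincipal x
    convert h
    ext y
    constructor
    · rintro rfl
      exact ⟨hx, rfl⟩
    · exact fun h => h.2
  · exact h

theorem mem_all {η : Ordinal.{u}} {U : Set (Set Ordinal.{u})} (hU : IsNormalMeasure η U)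
    {θ : Ordinal.{u}} (hθ : θ < η) {P : Ordinal.{u} → Ordinal.{u} → Prop}
    (hP : ∀ ξ < θ, {x | x < η ∧ P ξ x} ∈ U) : {x | x < η ∧ ∀ ξ < θ, P ξ x} ∈ U := by
  refine hU.superset_mem _ (hU.complete θ hθ (fun ξ => {x | x < η ∧ P ξ x}) hP) _
    (fun _ hx => hx.1) ?_
  rintro x ⟨hx, h⟩
  refine ⟨hx, fun ξ hξ => ?_⟩
  simp only [Set.mem_iInter] at h
  exact (h ξ hξ).2

theorem mem_gt {η : Ordinal.{u}} {U : Set (Set Ordinal.{u})} (hU : IsNormalMeasure η U)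
    {θ : Ordinal.{u}} (hθ : θ < η) : {x | x < η ∧ θ < x} ∈ U := by
  refine mem_mono hU (mem_and hU (mem_all hU hθ (P := fun ξ x => x ≠ ξ)
    (fun ξ _ => mem_ne hU ξ)) (mem_ne hU θ)) ?_
  rintro x _ ⟨h1, h2⟩
  rcases lt_trichotomy x θ with h | h | h
  · exact absurd rfl (h1 x h)
  · exact absurd h h2
  · exact h

theorem omega_lt {η : Ordinal.{u}} {U : Set (Set Ordinal.{u})} (hU : IsNormalMeasure η U) :
    Ordinal.omega0 < η := by
  by_contra hcon
  push Not at hcon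
  have h := hU.normal (fun ξ => {x | x < η ∧ x ≠ Order.succ ξ}) (fun ξ _ => mem_ne hU _)
  obtain ⟨x, hx, hx0, hxs⟩ := mem_exists hU (mem_and hU (mem_ne hU 0) h)
  obtain ⟨n, rfl⟩ := Ordinal.lt_omega0.1 (hx.trans_le hcon)
  cases n with
  | zero => simp at hx0
  | succ n =>
    have h1 := hxs (n : Ordinal) (by exact_mod_cast Nat.lt_succ_self n)
    apply h1.2
    simp

theorem mem_nat {η : Ordinal.{u}} {U : Set (Set Ordinal.{u})} (hU : IsNormalMeasure η U)
    {P : ℕ → Ordinal.{u} → Prop}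
    (hP : ∀ n, {x | x < η ∧ P n x} ∈ U) : {x | x < η ∧ ∀ n, P n x} ∈ U := by
  refine mem_mono hU (mem_all hU (omega_lt hU)
    (P := fun ξ x => ∀ n : ℕ, ξ = n → P n x) ?_) ?_
  · intro ξ hξ
    obtain ⟨n, rfl⟩ := Ordinal.lt_omega0.1 hξ
    refine mem_mono hU (hP n) ?_
    intro x _ hx m hm
    have : n = m := by exact_mod_cast hm
    exact this ▸ hx
  · intro x _ hx n
    exact hx n (Ordinal.natCast_lt_omega0 n) n rfl

/-- The integral of the measures `f μ` along `V`. -/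
def comp (ν : Ordinal.{u}) (f : Ordinal.{u} → Set (Set Ordinal.{u}))
    (V : Set (Set Ordinal.{u})) : Set (Set Ordinal.{u}) :=
  {X | X ⊆ Set.Iio ν ∧ {μ | μ < ν ∧ X ∩ Set.Iio μ ∈ f μ} ∈ V}

theorem comp_normal {η : Ordinal.{u}} {U : Set (Set Ordinal.{u})} (hU : IsNormalMeasure η U)
    {f : Ordinal.{u} → Set (Set Ordinal.{u})}
    (hf : {μ | μ < η ∧ IsNormalMeasure μ (f μ)} ∈ U) : IsNormalMeasure η (comp η f U) where
  subset_iio X hX := hX.1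
  univ_mem := by
    refine ⟨subset_rfl, mem_mono hU hf ?_⟩
    intro x hx h
    have : Set.Iio η ∩ Set.Iio x = Set.Iio x :=
      Set.inter_eq_right.2 (Set.Iio_subset_Iio hx.le)
    rw [this]
    exact h.univ_mem
  superset_mem X hX Y hY hXY := by
    refine ⟨hY, mem_mono hU (mem_and hU hf hX.2) ?_⟩
    rintro x hx ⟨h, h2⟩
    exact h.superset_mem _ h2 _ Set.inter_subset_right (Set.inter_subset_inter_left _ hXY)
  inter_mem X hX Y hY := by
    refine ⟨Set.inter_subset_left.trans hX.1, mem_mono hU (mem_and hU hf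
      (mem_and hU hX.2 hY.2)) ?_⟩
    rintro x hx ⟨h, h2, h3⟩
    rw [Set.inter_inter_distrib_right]
    exact h.inter_mem _ h2 _ h3
  empty_not_mem hX := by
    obtain ⟨x, hx, h, h2⟩ := mem_exists hU (mem_and hU hf hX.2)
    rw [Set.empty_inter] at h2
    exact h.empty_not_mem h2
  ultra X hX := by
    rcases mem_compl hU (fun μ => X ∩ Set.Iio μ ∈ f μ) with h | h
    · exact Or.inl ⟨hX, h⟩
    · refine Or.inr ⟨Set.sdiff_subset, mem_mono hU (mem_and hU hf h) ?_⟩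
      rintro x hx ⟨h, h2⟩
      rcases h.ultra (X ∩ Set.Iio x) Set.inter_subset_right with h3 | h3
      · exact absurd h3 h2
      · refine h.superset_mem _ h3 _ Set.inter_subset_right ?_
        rintro y ⟨hy, hy2⟩
        exact ⟨⟨lt_trans hy hx, fun hyX => hy2 ⟨hyX, hy⟩⟩, hy⟩
  nonprincipal α hX := by
    obtain ⟨x, hx, h, h2⟩ := mem_exists hU (mem_and hU hf hX.2)
    by_cases hα : α < x
    · rw [Set.inter_eq_left.2 (Set.singleton_subset_iff.2 (Set.mem_Iio.2 hα))] at h2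
      exact h.nonprincipal α h2
    · have : ({α} : Set Ordinal.{u}) ∩ Set.Iio x = ∅ := by
        ext y
        simp only [Set.mem_inter_iff, Set.mem_singleton_iff, Set.mem_Iio,
          Set.mem_empty_iff_false, iff_false]
        rintro ⟨rfl, h⟩
        exact hα h
      rw [this] at h2
      exact h.empty_not_mem h2
  complete θ hθ A hA := by
    refine ⟨Set.inter_subset_left, mem_mono hU (mem_and hU hf (mem_and hU (mem_gt hU hθ)
      (mem_all hU hθ (fun ξ hξ => (hA ξ hξ).2)))) ?_⟩
    rintro x hx ⟨h, h2, h3⟩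
    refine h.superset_mem _ (h.complete θ h2 _ h3) _ Set.inter_subset_right ?_
    rintro y ⟨hy, hy2⟩
    simp only [Set.mem_iInter] at hy2
    refine ⟨⟨lt_trans hy hx, ?_⟩, hy⟩
    simp only [Set.mem_iInter]
    exact fun ξ hξ => (hy2 ξ hξ).1
  normal A hA := by
    refine ⟨fun _ hx => hx.1, mem_mono hU (mem_and hU hf (hU.normal _
      (fun ξ hξ => (hA ξ hξ).2))) ?_⟩
    rintro x hx ⟨h, h3⟩
    refine h.superset_mem _ (h.normal (fun ξ => A ξ ∩ Set.Iio x) (fun ξ hξ => (h3 ξ hξ).2)) _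
      Set.inter_subset_right ?_
    rintro y ⟨hy, hy2⟩
    exact ⟨⟨lt_trans hy hx, fun ξ hξ => (hy2 ξ hξ).1⟩, hy⟩

theorem comp_assoc (η : Ordinal.{u}) (f g : Ordinal.{u} → Set (Set Ordinal.{u}))
    (U : Set (Set Ordinal.{u})) :
    comp η f (comp η g U) = comp η (fun ν => comp ν f (g ν)) U := by
  have key : ∀ X : Set Ordinal.{u},
      {ν | ν < η ∧ {μ | μ < η ∧ X ∩ Set.Iio μ ∈ f μ} ∩ Set.Iio ν ∈ g ν} =
      {ν | ν < η ∧ X ∩ Set.Iio ν ∈ comp ν f (g ν)} := by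
    intro X
    ext ν
    refine and_congr_right fun hν => ?_
    have : {μ | μ < η ∧ X ∩ Set.Iio μ ∈ f μ} ∩ Set.Iio ν =
        {μ | μ < ν ∧ X ∩ Set.Iio ν ∩ Set.Iio μ ∈ f μ} := by
      ext μ
      constructor
      · rintro ⟨⟨_, h⟩, h2⟩
        refine ⟨h2, ?_⟩
        rwa [Set.inter_assoc, Set.inter_eq_right.2 (Set.Iio_subset_Iio (le_of_lt h2))]
      · rintro ⟨h2, h⟩
        rw [Set.inter_assoc, Set.inter_eq_right.2 (Set.Iio_subset_Iio (le_of_lt h2))] at h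
        exact ⟨⟨h2.trans hν, h⟩, h2⟩
    rw [this]
    exact ⟨fun h => ⟨Set.inter_subset_right, h⟩, fun h => h.2⟩
  ext X
  constructor
  · rintro ⟨h1, -, h2⟩
    refine ⟨h1, ?_⟩
    rwa [← key]
  · rintro ⟨h1, h2⟩
    refine ⟨h1, fun _ h => h.1, ?_⟩
    rwa [key]

/-- Representatives of the terms of a descending sequence in the ultrapower by its first term. -/
def rep (g : ℕ → Ordinal.{u} → Set (Set Ordinal.{u})) : ℕ → Ordinal.{u} → Set (Set Ordinal.{u})
  | 0 => g 0
  | n + 1 => fun ν => comp ν (g (n + 1)) (rep g n ν)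

theorem no_chain (η : Ordinal.{u}) : ∀ U : ℕ → Set (Set Ordinal.{u}),
    (∀ n, IsNormalMeasure η (U n)) → (∀ n, MitchellLt η (U (n + 1)) (U n)) → False := by
  induction η using WellFoundedLT.induction with
  | ind η ih =>
    intro U hU hlt
    choose g hg using hlt
    have hc : ∀ n, U (n + 1) = comp η (g n) (U n) := fun n => (hg n).2
    have hr : ∀ n, U (n + 1) = comp η (rep g n) (U 0) := by
      intro n
      induction n with
      | zero => exact hc 0
      | succ n ihn =>
        rw [hc (n + 1), ihn, comp_assoc]
        rfl
    have h2 : ∀ n, {ν | ν < η ∧ {μ | μ < ν ∧ IsNormalMeasure μ (g (n + 1) μ)} ∈ rep g n ν}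
        ∈ U 0 := by
      intro n
      have h := (hg (n + 1)).1
      rw [hr n] at h
      refine mem_mono (hU 0) h.2 ?_
      intro ν hν h
      convert h using 1
      ext μ
      constructor
      · rintro ⟨a, b⟩
        exact ⟨⟨a.trans hν, b⟩, a⟩
      · rintro ⟨⟨_, b⟩, a⟩
        exact ⟨a, b⟩
    have h1 : ∀ n, {ν | ν < η ∧ IsNormalMeasure ν (rep g n ν)} ∈ U 0 := by
      intro n
      induction n with
      | zero => exact (hg 0).1
      | succ n ihn =>
        refine mem_mono (hU 0) (mem_and (hU 0) ihn (h2 n)) ?_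
        rintro ν _ ⟨a, b⟩
        exact comp_normal a b
    obtain ⟨ν, hν, h⟩ := mem_exists (hU 0)
      (mem_nat (hU 0) (fun n => mem_and (hU 0) (h1 n) (h2 n)))
    exact ih ν hν (fun n => rep g n ν) (fun n => (h n).1)
      (fun n => ⟨g (n + 1), (h n).2, rfl⟩)

end MitchellAux

/-- The combinatorial Mitchell order is well-founded on the normal measures on any
ordinal `η`. -/
theorem mitchell_wellFounded (η : Ordinal) :
    WellFounded (fun W U : {U : Set (Set Ordinal) // IsNormalMeasure η U} =>
      MitchellLt η W.val U.val) := by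
  rw [wellFounded_iff_isEmpty_descending_chain]
  constructor
  rintro ⟨f, hf⟩
  exact MitchellAux.no_chain η (fun n => (f n).val) (fun n => (f n).property) hf
end

section
/- Let m and n be natural numbers with m < n, and let κ be an ordinal carrying a ◁-chain of normal measures of length n. Then there exists a normal measure U on κ such that the set {α < κ : there is a ◁-chain of length m on α but no ◁-chain of length m+1 on α} belongs to U. (Every measurable cardinal of Mitchell order at least n has a normal measure concentrating on the ordinals of Mitchell order exactly m.) -/
/-- A ◁-chain of length `n` of normal measures on `η`: measures `W 1, …, W n` with
`W i ◁ W (i+1)` for `1 ≤ i < n`. Every ordinal has a chain of length `0`. -/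
def HasMitchellChain (η : Ordinal) (n : ℕ) : Prop :=
  ∃ W : ℕ → Set (Set Ordinal),
    (∀ i, 1 ≤ i → i ≤ n → IsNormalMeasure η (W i)) ∧
    (∀ i, 1 ≤ i → i + 1 ≤ n → MitchellLt η (W i) (W (i + 1)))

theorem IsNormalMeasure.mono1 {η : Ordinal} {U : Set (Set Ordinal)} (hU : IsNormalMeasure η U)
    {X : Set Ordinal} (hX : X ∈ U) {q : Ordinal → Prop}
    (h : ∀ ν < η, ν ∈ X → q ν) : {ν | ν < η ∧ q ν} ∈ U :=
  hU.superset_mem X hX _ (fun _ h => h.1)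
    (fun ν hν => ⟨hU.subset_iio X hX hν, h ν (hU.subset_iio X hX hν) hν⟩)

theorem IsNormalMeasure.mono2 {η : Ordinal} {U : Set (Set Ordinal)} (hU : IsNormalMeasure η U)
    {X Y : Set Ordinal} (hX : X ∈ U) (hY : Y ∈ U) {q : Ordinal → Prop}
    (h : ∀ ν < η, ν ∈ X → ν ∈ Y → q ν) : {ν | ν < η ∧ q ν} ∈ U :=
  hU.mono1 (hU.inter_mem X hX Y hY) (fun ν h1 h2 => h ν h1 h2.1 h2.2)

theorem IsNormalMeasure.mono3 {η : Ordinal} {U : Set (Set Ordinal)} (hU : IsNormalMeasure η U)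
    {X Y Z : Set Ordinal} (hX : X ∈ U) (hY : Y ∈ U) (hZ : Z ∈ U) {q : Ordinal → Prop}
    (h : ∀ ν < η, ν ∈ X → ν ∈ Y → ν ∈ Z → q ν) : {ν | ν < η ∧ q ν} ∈ U :=
  hU.mono2 (hU.inter_mem X hX Y hY) hZ (fun ν h1 h2 h3 => h ν h1 h2.1 h2.2 h3)

theorem IsNormalMeasure.exists_mem {η : Ordinal} {U : Set (Set Ordinal)}
    (hU : IsNormalMeasure η U) {X : Set Ordinal} (hX : X ∈ U) : ∃ ν < η, ν ∈ X := by
  by_contra! hc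
  apply hU.empty_not_mem
  have : X = ∅ := Set.eq_empty_of_forall_notMem
    (fun ν hν => hc ν (hU.subset_iio X hX hν) hν)
  rwa [← this]

theorem IsNormalMeasure.compl_singleton {η : Ordinal} {U : Set (Set Ordinal)}
    (hU : IsNormalMeasure η U) {α : Ordinal} (hα : α < η) : Set.Iio η \ {α} ∈ U := by
  rcases hU.ultra {α} (by simpa using hα) with h | h
  · exact absurd h (hU.nonprincipal α)
  · exact h

theorem IsNormalMeasure.tail {η : Ordinal} {U : Set (Set Ordinal)}
    (hU : IsNormalMeasure η U) {θ : Ordinal} (hθ : θ < η) : {ν | ν < η ∧ θ < ν} ∈ U := by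
  have h1 := hU.complete θ hθ (fun ξ => Set.Iio η \ {ξ})
    (fun ξ hξ => hU.compl_singleton (hξ.trans hθ))
  refine hU.mono2 h1 (hU.compl_singleton hθ) ?_
  intro ν _ h2 h3
  by_contra hc
  rcases lt_or_eq_of_le (not_lt.mp hc) with h | h
  · have := h2.2
    simp only [Set.mem_iInter] at this
    exact (this ν h).2 rfl
  · exact h3.2 h

/-- The integral of a family of measures `g` along `U`. -/
def mInt (η : Ordinal) (g : Ordinal → Set (Set Ordinal)) (U : Set (Set Ordinal)) :
    Set (Set Ordinal) :=
  {X | X ⊆ Set.Iio η ∧ {ν | ν < η ∧ X ∩ Set.Iio ν ∈ g ν} ∈ U}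

theorem mInt_normal {η : Ordinal} {g : Ordinal → Set (Set Ordinal)} {U : Set (Set Ordinal)}
    (hU : IsNormalMeasure η U) (hg : {ν | ν < η ∧ IsNormalMeasure ν (g ν)} ∈ U) :
    IsNormalMeasure η (mInt η g U) where
  subset_iio X hX := hX.1
  univ_mem := by
    refine ⟨subset_rfl, hU.mono1 hg ?_⟩
    rintro ν hν ⟨_, h⟩
    have : Set.Iio η ∩ Set.Iio ν = Set.Iio ν :=
      Set.inter_eq_right.mpr (Set.Iio_subset_Iio hν.le)
    rw [this]; exact h.univ_mem
  superset_mem := by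
    rintro X ⟨_, hX⟩ Y hY hXY
    refine ⟨hY, hU.mono2 hg hX ?_⟩
    rintro ν hν ⟨_, h⟩ ⟨_, h2⟩
    exact h.superset_mem _ h2 _ Set.inter_subset_right (Set.inter_subset_inter_left _ hXY)
  inter_mem := by
    rintro X ⟨hXs, hX⟩ Y ⟨hYs, hY⟩
    refine ⟨fun x hx => hXs hx.1, hU.mono3 hg hX hY ?_⟩
    rintro ν hν ⟨_, h⟩ ⟨_, h2⟩ ⟨_, h3⟩
    have := h.inter_mem _ h2 _ h3
    rwa [← Set.inter_inter_distrib_right] at this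
  empty_not_mem := by
    rintro ⟨_, h⟩
    obtain ⟨ν, _, ⟨_, h1⟩, ⟨_, h2⟩⟩ := hU.exists_mem (hU.inter_mem _ hg _ h)
    rw [Set.empty_inter] at h2
    exact h1.empty_not_mem h2
  ultra := by
    intro X hX
    rcases hU.ultra {ν | ν < η ∧ X ∩ Set.Iio ν ∈ g ν} (fun _ h => h.1) with h | h
    · exact Or.inl ⟨hX, h⟩
    · refine Or.inr ⟨Set.diff_subset, hU.mono2 hg h ?_⟩
      rintro ν hν ⟨_, h1⟩ ⟨_, h2⟩
      rcases h1.ultra (X ∩ Set.Iio ν) Set.inter_subset_right with h3 | h3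
      · exact absurd ⟨hν, h3⟩ h2
      · refine h1.superset_mem _ h3 _ Set.inter_subset_right ?_
        rintro x ⟨hx, hx2⟩
        exact ⟨⟨lt_trans hx hν, fun h => hx2 ⟨h, hx⟩⟩, hx⟩
  nonprincipal := by
    rintro α ⟨_, h⟩
    obtain ⟨ν, _, ⟨_, h1⟩, ⟨_, h2⟩⟩ := hU.exists_mem (hU.inter_mem _ hg _ h)
    by_cases hα : α < ν
    · rw [Set.inter_eq_left.mpr (by simpa using hα)] at h2
      exact h1.nonprincipal α h2
    · have : ({α} : Set Ordinal) ∩ Set.Iio ν = ∅ := by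
        ext x; simp; rintro rfl; exact not_lt.mp hα
      rw [this] at h2
      exact h1.empty_not_mem h2
  complete := by
    intro θ hθ A hA
    refine ⟨Set.inter_subset_left, ?_⟩
    have h1 := hU.complete θ hθ (fun ξ => {ν | ν < η ∧ A ξ ∩ Set.Iio ν ∈ g ν})
      (fun ξ hξ => (hA ξ hξ).2)
    refine hU.mono3 hg (hU.tail hθ) h1 ?_
    rintro ν hν ⟨_, h⟩ ⟨_, hθν⟩ ⟨_, h2⟩
    simp only [Set.mem_iInter] at h2
    have h3 := h.complete θ hθν (fun ξ => A ξ ∩ Set.Iio ν) (fun ξ hξ => (h2 ξ hξ).2)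
    refine h.superset_mem _ h3 _ Set.inter_subset_right ?_
    rintro x ⟨hx, hx2⟩
    simp only [Set.mem_iInter] at hx2
    refine ⟨⟨lt_trans hx hν, ?_⟩, hx⟩
    simp only [Set.mem_iInter]
    exact fun ξ hξ => (hx2 ξ hξ).1
  normal := by
    intro A hA
    refine ⟨fun _ h => h.1, ?_⟩
    have h1 := hU.normal (fun ξ => {ν | ν < η ∧ A ξ ∩ Set.Iio ν ∈ g ν})
      (fun ξ hξ => (hA ξ hξ).2)
    refine hU.mono2 hg h1 ?_
    rintro ν hν ⟨_, h⟩ ⟨_, h2⟩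
    have h3 := h.normal (fun ξ => A ξ ∩ Set.Iio ν) (fun ξ hξ => (h2 ξ hξ).2)
    refine h.superset_mem _ h3 _ Set.inter_subset_right ?_
    rintro x ⟨hx, hx2⟩
    exact ⟨⟨lt_trans hx hν, fun ξ hξ => (hx2 ξ hξ).1⟩, hx⟩

/-- Reflecting membership in a measure below `U`. -/
theorem restrict_Iio {η ν : Ordinal} (hν : ν < η) (q : Ordinal → Prop) :
    {μ | μ < η ∧ q μ} ∩ Set.Iio ν = {μ | μ < ν ∧ q μ} := by
  ext μ
  exact ⟨fun h => ⟨h.2, h.1.2⟩, fun h => ⟨⟨lt_trans h.1 hν, h.2⟩, h.1⟩⟩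

theorem mInt_inter {η ν : Ordinal} (hν : ν < η) {g : Ordinal → Set (Set Ordinal)}
    {F : Set (Set Ordinal)} (X : Set Ordinal) :
    X ∩ Set.Iio ν ∈ mInt ν g F ↔
      {μ | μ < η ∧ X ∩ Set.Iio μ ∈ g μ} ∩ Set.Iio ν ∈ F := by
  rw [restrict_Iio hν]
  have : {μ | μ < ν ∧ X ∩ Set.Iio ν ∩ Set.Iio μ ∈ g μ} = {μ | μ < ν ∧ X ∩ Set.Iio μ ∈ g μ} := by
    ext μ
    refine and_congr_right fun h => ?_
    rw [Set.inter_assoc, Set.inter_eq_right.mpr (Set.Iio_subset_Iio h.le)]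
  constructor
  · rintro ⟨_, h⟩
    rwa [this] at h
  · intro h
    refine ⟨Set.inter_subset_right, ?_⟩
    rwa [this]

theorem chain_reflect {η : Ordinal} {U : Set (Set Ordinal)} (hU : IsNormalMeasure η U)
    (W : ℕ → Set (Set Ordinal)) (k : ℕ) : ∀ (f : Ordinal → Set (Set Ordinal)),
    (∀ i, 1 ≤ i → i ≤ k + 1 → IsNormalMeasure η (W i)) →
    (∀ i, 1 ≤ i → i + 1 ≤ k + 1 → MitchellLt η (W i) (W (i + 1))) →
    MitchellWitness η f (W (k + 1)) U →
    {ν | ν < η ∧ ∃ V : ℕ → Set (Set Ordinal),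
      (∀ i, 1 ≤ i → i ≤ k + 1 → IsNormalMeasure ν (V i)) ∧
      (∀ i, 1 ≤ i → i + 1 ≤ k + 1 → MitchellLt ν (V i) (V (i + 1))) ∧ V (k + 1) = f ν} ∈ U := by
  induction k with
  | zero =>
    rintro f _ _ ⟨hf, _⟩
    refine hU.mono1 hf ?_
    rintro ν _ ⟨_, h⟩
    exact ⟨fun _ => f ν, fun _ _ _ => h, fun i _ _ => by omega, rfl⟩
  | succ k ih =>
    rintro f hW hlt ⟨hf, hfW⟩
    obtain ⟨g, hg, hgW⟩ := hlt (k + 1) (by omega) le_rfl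
    have hgood : {ν | ν < η ∧ {μ | μ < ν ∧ IsNormalMeasure μ (g μ)} ∈ f ν} ∈ U := by
      rw [hfW] at hg
      refine hU.mono1 hg.2 ?_
      rintro ν hν ⟨_, h⟩
      rwa [restrict_Iio hν] at h
    have hw : MitchellWitness η (fun ν => mInt ν g (f ν)) (W (k + 1)) U := by
      refine ⟨hU.mono2 hf hgood fun ν _ h1 h2 => mInt_normal h1.2 h2.2, ?_⟩
      rw [hgW]
      ext X
      refine and_congr_right fun hX => ?_
      have : {ν | ν < η ∧ X ∩ Set.Iio ν ∈ mInt ν g (f ν)} =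
          {ν | ν < η ∧ {μ | μ < η ∧ X ∩ Set.Iio μ ∈ g μ} ∩ Set.Iio ν ∈ f ν} := by
        ext ν
        exact and_congr_right fun h => mInt_inter h X
      rw [this, hfW]
      exact ⟨fun h => h.2, fun h => ⟨fun _ h => h.1, h⟩⟩
    have := ih _ (fun i h1 h2 => hW i h1 (by omega)) (fun i h1 h2 => hlt i h1 (by omega)) hw
    refine hU.mono3 hf hgood this ?_
    rintro ν hν ⟨_, h1⟩ ⟨_, h2⟩ ⟨_, V, hV, hVlt, hVe⟩
    refine ⟨fun i => if i ≤ k + 1 then V i else f ν, ?_, ?_, by simp⟩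
    · intro i hi hi2
      by_cases h : i ≤ k + 1
      · simpa [h] using hV i hi h
      · simpa [h] using h1
    · intro i hi hi2
      by_cases h : i + 1 ≤ k + 1
      · have h' : i ≤ k + 1 := by omega
        simpa only [h, h', if_true] using hVlt i hi h
      · have h' : i = k + 1 := by omega
        subst h'
        simp only [h, le_refl, if_true, if_false]
        exact ⟨g, h2, hVe⟩

theorem chain_mem {η : Ordinal} (m : ℕ) (W : ℕ → Set (Set Ordinal))
    (hW : ∀ i, 1 ≤ i → i ≤ m + 1 → IsNormalMeasure η (W i))
    (hlt : ∀ i, 1 ≤ i → i + 1 ≤ m + 1 → MitchellLt η (W i) (W (i + 1))) :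
    {ν | ν < η ∧ HasMitchellChain ν m} ∈ W (m + 1) := by
  have hU := hW (m + 1) (by omega) le_rfl
  cases m with
  | zero =>
    exact hU.mono1 hU.univ_mem fun ν _ _ =>
      ⟨fun _ => ∅, fun i _ _ => by omega, fun i _ _ => by omega⟩
  | succ k =>
    obtain ⟨f, hf⟩ := hlt (k + 1) (by omega) le_rfl
    refine hU.mono1 (chain_reflect hU W k f (fun i h1 h2 => hW i h1 (by omega))
      (fun i h1 h2 => hlt i h1 (by omega)) hf) ?_
    rintro ν _ ⟨_, V, h1, h2, _⟩
    exact ⟨V, h1, h2⟩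

theorem exact_order_aux (m : ℕ) (κ : Ordinal) : HasMitchellChain κ (m + 1) →
    ∃ U, IsNormalMeasure κ U ∧
      {α | α < κ ∧ HasMitchellChain α m ∧ ¬ HasMitchellChain α (m + 1)} ∈ U := by
  induction κ using WellFoundedLT.induction with
  | ind κ ih =>
    rintro ⟨W, hW, hlt⟩
    have hU := hW (m + 1) (by omega) le_rfl
    have hm := chain_mem m W hW hlt
    rcases hU.ultra {ν | ν < κ ∧ HasMitchellChain ν (m + 1)} (fun _ h => h.1) with h | h
    · choose! G hG1 hG2 using ih
      have hg : {ν | ν < κ ∧ IsNormalMeasure ν (G ν)} ∈ W (m + 1) :=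
        hU.mono1 h fun ν hν h1 => hG1 ν hν h1.2
      refine ⟨_, mInt_normal hU hg, fun _ h => h.1, hU.mono1 h ?_⟩
      intro ν hν h1
      rw [restrict_Iio hν]
      exact hG2 ν hν h1.2
    · exact ⟨_, hU, hU.mono2 hm h fun ν hν h1 h2 => ⟨h1.2, fun h3 => h2.2 ⟨hν, h3⟩⟩⟩

/-- If `m < n` and `κ` carries a ◁-chain of length `n`, then some normal measure on `κ`
concentrates on the ordinals carrying a ◁-chain of length exactly `m`. -/
theorem measure_on_exact_order (m n : ℕ) (hmn : m < n) (κ : Ordinal)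
    (h : HasMitchellChain κ n) :
    ∃ U, IsNormalMeasure κ U ∧
      {α | α < κ ∧ HasMitchellChain α m ∧ ¬ HasMitchellChain α (m + 1)} ∈ U := by
  obtain ⟨W, hW, hlt⟩ := h
  exact exact_order_aux m κ ⟨W, fun i h1 h2 => hW i h1 (by omega),
    fun i h1 h2 => hlt i h1 (by omega)⟩
end

section
/- Let η be an ordinal and let U_u, U_t, U_s be normal measures on η with U_u ◁ U_t, U_t ◁ U_s and U_u ◁ U_s. Let g_u be a witness for U_u ◁ U_s and g_t a witness for U_t ◁ U_s. Then the set {ν < η : g_u(ν) and g_t(ν) are normal measures on ν and g_u(ν) ◁ g_t(ν)} belongs to U_s. -/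
theorem nm_mono {η : Ordinal} {U : Set (Set Ordinal)} (hU : IsNormalMeasure η U)
    {P Q : Ordinal → Prop} (hP : {ν | ν < η ∧ P ν} ∈ U) (h : ∀ ν < η, P ν → Q ν) :
    {ν | ν < η ∧ Q ν} ∈ U :=
  hU.superset_mem _ hP _ (fun _ hx => hx.1) (fun x hx => ⟨hx.1, h x hx.1 hx.2⟩)

theorem nm_and {η : Ordinal} {U : Set (Set Ordinal)} (hU : IsNormalMeasure η U)
    {P Q : Ordinal → Prop} (hP : {ν | ν < η ∧ P ν} ∈ U) (hQ : {ν | ν < η ∧ Q ν} ∈ U) :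
    {ν | ν < η ∧ (P ν ∧ Q ν)} ∈ U :=
  hU.superset_mem _ (hU.inter_mem _ hP _ hQ) _ (fun _ hx => hx.1)
    (fun _ hx => ⟨hx.1.1, hx.1.2, hx.2.2⟩)

theorem nm_not {η : Ordinal} {U : Set (Set Ordinal)} (hU : IsNormalMeasure η U)
    {P : Ordinal → Prop} (hP : {ν | ν < η ∧ P ν} ∉ U) : {ν | ν < η ∧ ¬ P ν} ∈ U := by
  rcases hU.ultra {ν | ν < η ∧ P ν} (fun _ hx => hx.1) with h | h
  · exact absurd h hP
  · exact hU.superset_mem _ h _ (fun _ hx => hx.1) (fun x hx => ⟨hx.1, fun hp => hx.2 ⟨hx.1, hp⟩⟩)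

/-- The truth value of a property is decided almost everywhere. -/
theorem nm_dec {η : Ordinal} {U : Set (Set Ordinal)} (hU : IsNormalMeasure η U)
    (P : Ordinal → Prop) : {ν | ν < η ∧ (P ν ↔ {ν | ν < η ∧ P ν} ∈ U)} ∈ U := by
  by_cases h : {ν | ν < η ∧ P ν} ∈ U
  · exact nm_mono hU h (fun _ _ hp => by simp only [hp, h])
  · exact nm_mono hU (nm_not hU h) (fun _ _ hp => by simp only [hp, h])

theorem nm_const {η : Ordinal} {U : Set (Set Ordinal)} (hU : IsNormalMeasure η U)
    (X : Ordinal → Set Ordinal) : ∃ Y ⊆ Set.Iio η,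
      {ν | ν < η ∧ ∀ α < ν, (α ∈ X ν ↔ α ∈ Y)} ∈ U := by
  refine ⟨{α | α < η ∧ {ν | ν < η ∧ α ∈ X ν} ∈ U}, fun _ h => h.1, ?_⟩
  have := hU.normal (fun α => {ν | ν < η ∧ (α ∈ X ν ↔ {ν | ν < η ∧ α ∈ X ν} ∈ U)})
    (fun α _ => nm_dec hU _)
  refine nm_mono hU this (fun ν hν h α hα => ?_)
  rw [(h α hα).2]
  exact ⟨fun h => ⟨hα.trans hν, h⟩, fun h => h.2⟩

theorem witness_dec {η : Ordinal} {W U : Set (Set Ordinal)} (hU : IsNormalMeasure η U)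
    {g : Ordinal → Set (Set Ordinal)} (hg : MitchellWitness η g W U) {X : Set Ordinal}
    (hX : X ⊆ Set.Iio η) : {ν | ν < η ∧ (X ∩ Set.Iio ν ∈ g ν ↔ X ∈ W)} ∈ U := by
  have h : X ∈ W ↔ {ν | ν < η ∧ X ∩ Set.Iio ν ∈ g ν} ∈ U := by
    rw [hg.2]
    exact ⟨fun h => h.2, fun h => ⟨hX, h⟩⟩
  rw [h]
  exact nm_dec hU _

/-- If `U_u ◁ U_t ◁ U_s` and `U_u ◁ U_s` are normal measures on `η` with witnesses
`g_u` for `U_u ◁ U_s` and `g_t` for `U_t ◁ U_s`, then `U_s`-almost everywhere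
`g_u ν` and `g_t ν` are normal measures on `ν` with `g_u ν ◁ g_t ν`. -/
theorem witnesses_mitchell_lt_ae (η : Ordinal) (Uu Ut Us : Set (Set Ordinal))
    (hUu : IsNormalMeasure η Uu) (hUt : IsNormalMeasure η Ut)
    (hUs : IsNormalMeasure η Us)
    (hut : MitchellLt η Uu Ut) (hts : MitchellLt η Ut Us) (hus : MitchellLt η Uu Us)
    (gu gt : Ordinal → Set (Set Ordinal))
    (hgu : MitchellWitness η gu Uu Us) (hgt : MitchellWitness η gt Ut Us) :
    {ν | ν < η ∧ IsNormalMeasure ν (gu ν) ∧ IsNormalMeasure ν (gt ν) ∧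
      MitchellLt ν (gu ν) (gt ν)} ∈ Us := by
  obtain ⟨h, hh⟩ := hut
  have hN : {ν | ν < η ∧ {ξ | ξ < ν ∧ IsNormalMeasure ξ (h ξ)} ∈ gt ν} ∈ Us := by
    refine nm_mono hUs (witness_dec hUs hgt (X := {ξ | ξ < η ∧ IsNormalMeasure ξ (h ξ)})
      (fun _ hx => hx.1)) (fun ν hν e => ?_)
    have := e.2 hh.1
    convert this using 1
    ext ξ
    exact ⟨fun a => ⟨⟨a.1.trans hν, a.2⟩, a.1⟩, fun a => ⟨a.2, a.1.2⟩⟩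
  have hE : {ν | ν < η ∧ ∀ X ⊆ Set.Iio ν,
      (X ∈ gu ν ↔ {ξ | ξ < ν ∧ X ∩ Set.Iio ξ ∈ h ξ} ∈ gt ν)} ∈ Us := by
    by_contra hcon
    have hbad := nm_not hUs hcon
    have hch : ∀ ν, ∃ X : Set Ordinal, (¬ ∀ X ⊆ Set.Iio ν,
        (X ∈ gu ν ↔ {ξ | ξ < ν ∧ X ∩ Set.Iio ξ ∈ h ξ} ∈ gt ν)) → X ⊆ Set.Iio ν ∧
        ¬ (X ∈ gu ν ↔ {ξ | ξ < ν ∧ X ∩ Set.Iio ξ ∈ h ξ} ∈ gt ν) := by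
      intro ν
      by_cases hc : ∀ X ⊆ Set.Iio ν,
        (X ∈ gu ν ↔ {ξ | ξ < ν ∧ X ∩ Set.Iio ξ ∈ h ξ} ∈ gt ν)
      · exact ⟨∅, fun hn => absurd hc hn⟩
      · have hc' := hc
        push Not at hc'
        obtain ⟨X, hX, hX'⟩ := hc'
        exact ⟨X, fun _ => ⟨hX, by tauto⟩⟩
    choose X hX using hch
    obtain ⟨Y, hY, hYX⟩ := nm_const hUs X
    have hZ : {ξ | ξ < η ∧ Y ∩ Set.Iio ξ ∈ h ξ} ⊆ Set.Iio η := fun _ hx => hx.1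
    have key : Y ∈ Uu ↔ {ξ | ξ < η ∧ Y ∩ Set.Iio ξ ∈ h ξ} ∈ Ut := by
      rw [hh.2]
      exact ⟨fun a => a.2, fun a => ⟨hY, a⟩⟩
    have all := nm_and hUs hbad (nm_and hUs hYX
      (nm_and hUs (witness_dec hUs hgu hY) (witness_dec hUs hgt hZ)))
    refine hUs.empty_not_mem ?_
    convert all using 1
    symm
    rw [Set.eq_empty_iff_forall_notMem]
    rintro ν ⟨hν, hb, hyx, e1, e2⟩
    obtain ⟨hs, hne⟩ := hX ν hb
    apply hne
    have E1 : Y ∩ Set.Iio ν = X ν := by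
      ext α
      exact ⟨fun a => (hyx α a.2).2 a.1, fun a => ⟨(hyx α (hs a)).1 a, hs a⟩⟩
    have E2 : {ξ | ξ < η ∧ Y ∩ Set.Iio ξ ∈ h ξ} ∩ Set.Iio ν =
        {ξ | ξ < ν ∧ X ν ∩ Set.Iio ξ ∈ h ξ} := by
      have E3 : ∀ ξ < ν, X ν ∩ Set.Iio ξ = Y ∩ Set.Iio ξ := by
        intro ξ hξ
        ext α
        exact ⟨fun a => ⟨(hyx α (hs a.1)).1 a.1, a.2⟩,
          fun a => ⟨(hyx α (lt_trans a.2 hξ)).2 a.1, a.2⟩⟩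
      ext ξ
      constructor
      · rintro ⟨a, b⟩
        exact ⟨b, by rw [E3 ξ b]; exact a.2⟩
      · rintro ⟨a, b⟩
        rw [E3 ξ a] at b
        exact ⟨⟨a.trans hν, b⟩, a⟩
    rw [E1] at e1
    rw [E2] at e2
    rw [e1, e2, key]
  refine nm_mono hUs (nm_and hUs hgu.1 (nm_and hUs hgt.1 (nm_and hUs hN hE))) ?_
  rintro ν hν ⟨a, b, c, d⟩
  refine ⟨a, b, h, c, ?_⟩
  ext X
  exact ⟨fun hx => ⟨a.subset_iio X hx, (d X (a.subset_iio X hx)).1 hx⟩,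
    fun hx => (d X hx.1).2 hx.2⟩
end

section
/- Let η be an ordinal and let U_u, U_t, U_s be normal measures on η with U_u ◁ U_t, U_t ◁ U_s and U_u ◁ U_s. Let g_u be a witness for U_u ◁ U_s, let g_t be a witness for U_t ◁ U_s, and let h be a witness for U_u ◁ U_t. Then the set {ν < η : g_u(ν) = {X ⊆ ν : {μ < ν : X ∩ μ ∈ h(μ)} ∈ g_t(ν)}} belongs to U_s. (Almost everywhere with respect to U_s, the measure g_u(ν) is obtained from the restriction of h below ν as a witness over g_t(ν).) -/
theorem IsNormalMeasure.mem_not {η : Ordinal} {U : Set (Set Ordinal)}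
    (hU : IsNormalMeasure η U) (P : Ordinal → Prop)
    (hP : {ν | ν < η ∧ P ν} ∉ U) : {ν | ν < η ∧ ¬ P ν} ∈ U := by
  rcases hU.ultra {ν | ν < η ∧ P ν} (fun x hx => hx.1) with h1 | h1
  · exact absurd h1 hP
  · refine hU.superset_mem _ h1 _ (fun x hx => hx.1) ?_
    rintro x ⟨hx, hx2⟩
    exact ⟨hx, fun hp => hx2 ⟨hx, hp⟩⟩

theorem IsNormalMeasure.iff_mem {η : Ordinal} {U : Set (Set Ordinal)}
    (hU : IsNormalMeasure η U) (P Q : Ordinal → Prop)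
    (hPQ : {ν | ν < η ∧ P ν} ∈ U ↔ {ν | ν < η ∧ Q ν} ∈ U) :
    {ν | ν < η ∧ (P ν ↔ Q ν)} ∈ U := by
  by_cases hP : {ν | ν < η ∧ P ν} ∈ U
  · refine hU.superset_mem _ (hU.inter_mem _ hP _ (hPQ.1 hP)) _ (fun x hx => hx.1) ?_
    rintro x ⟨⟨hx, h1⟩, ⟨_, h2⟩⟩
    exact ⟨hx, by tauto⟩
  · refine hU.superset_mem _ (hU.inter_mem _ (hU.mem_not P hP) _
      (hU.mem_not Q (fun h => hP (hPQ.2 h)))) _ (fun x hx => hx.1) ?_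
    rintro x ⟨⟨hx, h1⟩, ⟨_, h2⟩⟩
    exact ⟨hx, by tauto⟩

/-- Every family of subsets `F ν ⊆ ν` is almost everywhere the trace of a single set. -/
theorem IsNormalMeasure.trace {η : Ordinal} {U : Set (Set Ordinal)}
    (hU : IsNormalMeasure η U) (F : Ordinal → Set Ordinal) :
    ∃ X ⊆ Set.Iio η, {ν | ν < η ∧ ∀ ξ < ν, (ξ ∈ F ν ↔ ξ ∈ X)} ∈ U := by
  refine ⟨{ξ | ξ < η ∧ {ν | ν < η ∧ ξ ∈ F ν} ∈ U}, fun x hx => hx.1, ?_⟩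
  have := hU.normal (fun ξ => {ν | ν < η ∧
    (ξ ∈ F ν ↔ ξ ∈ {ξ | ξ < η ∧ {ν | ν < η ∧ ξ ∈ F ν} ∈ U})}) ?_
  · refine hU.superset_mem _ this _ (fun x hx => hx.1) ?_
    rintro x ⟨hx, h1⟩
    exact ⟨hx, fun ξ hξ => (h1 ξ hξ).2⟩
  · intro ξ hξ
    by_cases hm : {ν | ν < η ∧ ξ ∈ F ν} ∈ U
    · refine hU.superset_mem _ hm _ (fun x hx => hx.1) ?_
      rintro x ⟨hx, h1⟩
      exact ⟨hx, ⟨fun _ => ⟨hξ, hm⟩, fun _ => h1⟩⟩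
    · refine hU.superset_mem _ (hU.mem_not _ hm) _ (fun x hx => hx.1) ?_
      rintro x ⟨hx, h1⟩
      exact ⟨hx, ⟨fun h => absurd h h1, fun h => absurd h.2 hm⟩⟩

/-- With `U_u ◁ U_t ◁ U_s`, `U_u ◁ U_s` normal measures on `η`, `g_u` a witness for
`U_u ◁ U_s`, `g_t` a witness for `U_t ◁ U_s`, and `h` a witness for `U_u ◁ U_t`:
`U_s`-almost everywhere `g_u ν` is the measure derived from `h` restricted below `ν`
over `g_t ν`. -/
theorem witness_canonical_representation (η : Ordinal) (Uu Ut Us : Set (Set Ordinal))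
    (hUu : IsNormalMeasure η Uu) (hUt : IsNormalMeasure η Ut)
    (hUs : IsNormalMeasure η Us)
    (hut : MitchellLt η Uu Ut) (hts : MitchellLt η Ut Us) (hus : MitchellLt η Uu Us)
    (gu gt h : Ordinal → Set (Set Ordinal))
    (hgu : MitchellWitness η gu Uu Us) (hgt : MitchellWitness η gt Ut Us)
    (hh : MitchellWitness η h Uu Ut) :
    {ν | ν < η ∧
      gu ν = {X | X ⊆ Set.Iio ν ∧ {μ | μ < ν ∧ X ∩ Set.Iio μ ∈ h μ} ∈ gt ν}} ∈ Us := by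
  by_contra hcon
  have hB := hUs.mem_not _ hcon
  have hF : ∀ ν, ∃ X : Set Ordinal, IsNormalMeasure ν (gu ν) →
      gu ν ≠ {X | X ⊆ Set.Iio ν ∧ {μ | μ < ν ∧ X ∩ Set.Iio μ ∈ h μ} ∈ gt ν} →
      X ⊆ Set.Iio ν ∧ ¬ (X ∈ gu ν ↔ {μ | μ < ν ∧ X ∩ Set.Iio μ ∈ h μ} ∈ gt ν) := by
    intro ν
    by_contra hno
    push Not at hno
    obtain ⟨hn, hne, -⟩ := hno ∅
    refine hne (Set.ext fun X => ?_)
    obtain ⟨-, -, hX⟩ := hno X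
    exact ⟨fun hx => ⟨hn.subset_iio X hx, (hX (hn.subset_iio X hx)).1 hx⟩,
      fun hx => (hX hx.1).2 hx.2⟩
  choose F hF using hF
  obtain ⟨X, hXη, hX⟩ := hUs.trace F
  have e1 : X ∈ Uu ↔ {ν | ν < η ∧ X ∩ Set.Iio ν ∈ gu ν} ∈ Us := by
    rw [hgu.2]; exact ⟨fun hx => hx.2, fun hx => ⟨hXη, hx⟩⟩
  have e2 : X ∈ Uu ↔ {ν | ν < η ∧ X ∩ Set.Iio ν ∈ h ν} ∈ Ut := by
    rw [hh.2]; exact ⟨fun hx => hx.2, fun hx => ⟨hXη, hx⟩⟩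
  have e3 : {ν | ν < η ∧ X ∩ Set.Iio ν ∈ h ν} ∈ Ut ↔
      {ν | ν < η ∧ {μ | μ < η ∧ X ∩ Set.Iio μ ∈ h μ} ∩ Set.Iio ν ∈ gt ν} ∈ Us := by
    rw [hgt.2]; exact ⟨fun hx => hx.2, fun hx => ⟨fun x hx => hx.1, hx⟩⟩
  have hD := hUs.iff_mem _ _ (e1.symm.trans (e2.trans e3))
  have hall := hUs.inter_mem _ (hUs.inter_mem _ hB _ hgu.1) _ (hUs.inter_mem _ hX _ hD)
  refine hUs.empty_not_mem ?_
  convert hall using 1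
  symm
  rw [Set.eq_empty_iff_forall_notMem]
  rintro ν ⟨⟨⟨hν, hne⟩, ⟨_, hn⟩⟩, ⟨⟨_, htr⟩, ⟨_, hiff⟩⟩⟩
  obtain ⟨hsub, hbad⟩ := hF ν hn hne
  have hEq : F ν = X ∩ Set.Iio ν := by
    ext ξ
    exact ⟨fun hx => ⟨(htr ξ (hsub hx)).1 hx, hsub hx⟩, fun hx => (htr ξ hx.2).2 hx.1⟩
  have hY : {μ | μ < ν ∧ F ν ∩ Set.Iio μ ∈ h μ} =
      {μ | μ < η ∧ X ∩ Set.Iio μ ∈ h μ} ∩ Set.Iio ν := by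
    have key : ∀ μ < ν, F ν ∩ Set.Iio μ = X ∩ Set.Iio μ := by
      intro μ hμ
      rw [hEq, Set.inter_assoc, Set.inter_eq_self_of_subset_right (Set.Iio_subset_Iio hμ.le)]
    ext μ
    constructor
    · rintro ⟨hμ, hm⟩
      exact ⟨⟨hμ.trans hν, key μ hμ ▸ hm⟩, hμ⟩
    · rintro ⟨⟨_, hm⟩, hμ⟩
      exact ⟨hμ, (key μ hμ).symm ▸ hm⟩
  rw [hY, hEq] at hbad
  exact hbad hiff
end

section
/- (Segerberg's completeness theorem.) If a modal formula φ is valid in every finite transitive irreflexive tree, then GL ⊢ φ. -/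
/-- Modal formulas: propositional variables, ⊥, implication, and □. -/
inductive ModalFormula : Type
  | var : ℕ → ModalFormula
  | bot : ModalFormula
  | imp : ModalFormula → ModalFormula → ModalFormula
  | box : ModalFormula → ModalFormula

/-- `φ` is a substitution instance of a propositional tautology: every Boolean
valuation of formulas commuting with `⊥` and `→` makes `φ` true. -/
def IsTautInstance (φ : ModalFormula) : Prop :=
  ∀ v : ModalFormula → Bool,
    v ModalFormula.bot = false →
    (∀ ψ χ, v (ModalFormula.imp ψ χ) = (!(v ψ) || v χ)) →
    v φ = true

/-- The provability logic GL: tautology instances, K, Löb, modus ponens, necessitation. -/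
inductive GLProof : ModalFormula → Prop
  | taut {φ} : IsTautInstance φ → GLProof φ
  | axK (φ ψ : ModalFormula) :
      GLProof ((ModalFormula.box (ModalFormula.imp φ ψ)).imp
        ((ModalFormula.box φ).imp (ModalFormula.box ψ)))
  | axLob (φ : ModalFormula) :
      GLProof ((ModalFormula.box ((ModalFormula.box φ).imp φ)).imp (ModalFormula.box φ))
  | mp {φ ψ} : GLProof (ModalFormula.imp φ ψ) → GLProof φ → GLProof ψ
  | nec {φ} : GLProof φ → GLProof (ModalFormula.box φ)

/-- Kripke satisfaction: the set of worlds of `(W, R)` at which a formula is true. -/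
def ksat {W : Type} (R : W → W → Prop) (v : ℕ → Set W) : ModalFormula → Set W
  | ModalFormula.var n => v n
  | ModalFormula.bot => ∅
  | ModalFormula.imp φ ψ => (ksat R v φ)ᶜ ∪ ksat R v ψ
  | ModalFormula.box φ => {w | ∀ x, R w x → x ∈ ksat R v φ}

/-- A finite transitive irreflexive tree: a finite frame with `R` transitive and
irreflexive, a root `r` with `R r w` for every `w ≠ r`, and the predecessors of each
world linearly ordered by `R`. -/
def IsFTITree {W : Type} (R : W → W → Prop) : Prop :=
  Finite W ∧ Transitive R ∧ Irreflexive R ∧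
  (∃ r : W, ∀ w : W, w ≠ r → R r w) ∧
  (∀ w u v : W, R u w → R v w → u = v ∨ R u v ∨ R v u)


namespace GLC
open ModalFormula

/-- Derivability from hypotheses (without necessitation on hypotheses). -/
inductive Der (G : Set ModalFormula) : ModalFormula → Prop
  | hyp {a} : a ∈ G → Der G a
  | thm {a} : GLProof a → Der G a
  | mp {a b} : Der G (imp a b) → Der G a → Der G b

theorem box_mono {a b : ModalFormula} (h : GLProof (imp a b)) :
    GLProof (imp (box a) (box b)) := (GLProof.axK a b).mp h.nec

theorem trans_imp {a b c : ModalFormula} (h : GLProof (imp a b)) (h' : GLProof (imp b c)) :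
    GLProof (imp a c) := by
  refine GLProof.mp (GLProof.mp (GLProof.taut ?_) h) h'
  intro v hb hi
  simp only [hi]
  cases v a <;> cases v b <;> cases v c <;> rfl

theorem ax4 (a : ModalFormula) : GLProof (imp (box a) (box (box a))) := by
  set t := imp (imp a (imp (box a) bot)) bot with ht
  have h1 : GLProof (imp t a) := by
    apply GLProof.taut
    intro v hb hi
    simp only [ht, hi, hb]
    cases v a <;> cases v (box a) <;> rfl
  have h2 : GLProof (imp t (box a)) := by
    apply GLProof.taut
    intro v hb hi
    simp only [ht, hi, hb]
    cases v a <;> cases v (box a) <;> rfl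
  have h3 : GLProof (imp a (imp (box t) t)) := by
    refine GLProof.mp (GLProof.taut ?_) (box_mono h1)
    intro v hb hi
    generalize box t = bt
    simp only [ht, hi, hb]
    cases v a <;> cases v (box a) <;> cases v bt <;> rfl
  exact trans_imp (trans_imp (box_mono h3) (GLProof.axLob t)) (box_mono h2)

theorem Der.mono {G H : Set ModalFormula} (hGH : G ⊆ H) {a : ModalFormula} (h : Der G a) :
    Der H a := by
  induction h with
  | hyp h => exact .hyp (hGH h)
  | thm h => exact .thm h
  | mp _ _ h1 h2 => exact .mp h1 h2

theorem Der.ded {G : Set ModalFormula} {a b : ModalFormula} (h : Der (insert a G) b) :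
    Der G (imp a b) := by
  have weak : ∀ c, Der G c → Der G (imp a c) := fun c hc => by
    refine .mp (.thm (.taut ?_)) hc
    intro v hb hi
    simp only [hi]
    cases v a <;> cases v c <;> rfl
  induction h with
  | @hyp c h =>
    rcases h with rfl | h
    · refine .thm (.taut ?_)
      intro v hb hi
      simp only [hi]
      cases v c <;> rfl
    · exact weak _ (.hyp h)
  | thm h => exact weak _ (.thm h)
  | @mp c d _ _ h1 h2 =>
    refine .mp (.mp (.thm (.taut ?_)) h1) h2
    intro v hb hi
    simp only [hi]
    cases v a <;> cases v c <;> cases v d <;> rfl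

/-- Maximal consistent sets. -/
structure MCS (M : Set ModalFormula) : Prop where
  closed : ∀ {a}, Der M a → a ∈ M
  nbot : bot ∉ M
  imp_iff : ∀ a b, imp a b ∈ M ↔ (a ∉ M ∨ b ∈ M)

theorem lindenbaum {G : Set ModalFormula} {a : ModalFormula} (h : ¬ Der G a) :
    ∃ M, G ⊆ M ∧ MCS M ∧ a ∉ M := by
  obtain ⟨M, hGM, hM⟩ := zorn_subset_nonempty {H : Set ModalFormula | ¬ Der H a} (by
    intro c hc hch hne
    refine ⟨⋃₀ c, ?_, fun s hs => Set.subset_sUnion_of_mem hs⟩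
    have key : ∀ b, Der (⋃₀ c) b → ∃ s ∈ c, Der s b := by
      intro b hb
      induction hb with
      | hyp h => obtain ⟨s, hs, hb⟩ := h; exact ⟨s, hs, .hyp hb⟩
      | thm h => obtain ⟨s, hs⟩ := hne; exact ⟨s, hs, .thm h⟩
      | mp _ _ h1 h2 =>
        obtain ⟨s, hs, h1⟩ := h1
        obtain ⟨t, ht, h2⟩ := h2
        rcases hch.total hs ht with hst | hst
        · exact ⟨t, ht, .mp (h1.mono hst) h2⟩
        · exact ⟨s, hs, .mp h1 (h2.mono hst)⟩
    intro hd
    obtain ⟨s, hs, hd⟩ := key a hd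
    exact hc hs hd) G h
  have hMa : ¬ Der M a := hM.prop
  have hins : ∀ b, b ∉ M → Der M (imp b a) := by
    intro b hb
    by_contra hcon
    apply hb
    have : ¬ Der (insert b M) a := fun hd => hcon hd.ded
    exact hM.le_of_ge this (Set.subset_insert b M) (Set.mem_insert b M)
  have hcl : ∀ {b}, Der M b → b ∈ M := by
    intro b hb
    by_contra hcon
    exact hMa (.mp (hins b hcon) hb)
  refine ⟨M, hGM, ⟨hcl, ?_, ?_⟩, fun hh => hMa (.hyp hh)⟩
  · intro hb
    refine hMa (.mp (.thm (.taut ?_)) (.hyp hb))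
    intro v hb hi
    simp only [hi, hb]
    rfl
  · intro b c
    constructor
    · intro hbc
      by_cases hb : b ∈ M
      · exact Or.inr (hcl (.mp (.hyp hbc) (.hyp hb)))
      · exact Or.inl hb
    · rintro (hb | hc)
      · by_contra hcon
        refine hMa (.mp (.mp (.thm (.taut ?_)) (hins _ hb)) (hins _ hcon))
        intro v hb hi
        simp only [hi]
        cases v a <;> cases v b <;> cases v c <;> rfl
      · apply hcl
        refine .mp (.thm (.taut ?_)) (.hyp hc)
        intro v hb hi
        simp only [hi]
        cases v b <;> cases v c <;> rfl

theorem box_der {M G : Set ModalFormula} (hM : MCS M) (hG : ∀ c ∈ G, box c ∈ M)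
    {a : ModalFormula} (h : Der G a) : box a ∈ M := by
  induction h with
  | hyp h => exact hG _ h
  | thm h => exact hM.closed (.thm h.nec)
  | mp _ _ h1 h2 => exact hM.closed (.mp (.mp (.thm (.axK _ _)) (.hyp h1)) (.hyp h2))

theorem exists_next {M : Set ModalFormula} (hM : MCS M) {a : ModalFormula} (ha : box a ∉ M) :
    ∃ N, MCS N ∧ (∀ c, box c ∈ M → c ∈ N ∧ box c ∈ N) ∧ box a ∈ N ∧ a ∉ N := by
  have hn : ¬ Der (insert (box a) {c | box c ∈ M}) a := by
    intro hd
    have := box_der hM (G := {c | box c ∈ M}) (fun c hc => hc) hd.ded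
    exact ha (hM.closed (.mp (.thm (.axLob a)) (.hyp this)))
  obtain ⟨N, hGN, hN, haN⟩ := lindenbaum hn
  refine ⟨N, hN, fun c hc => ⟨hGN (Or.inr hc), hGN (Or.inr ?_)⟩, hGN (Or.inl rfl), haN⟩
  exact hM.closed (.mp (.thm (ax4 c)) (.hyp hc))

open Classical in
/-- A chosen successor. -/
noncomputable def next (M : Set ModalFormula) (a : ModalFormula) : Set ModalFormula :=
  if h : MCS M ∧ box a ∉ M then Classical.choose (exists_next h.1 h.2) else M

theorem next_spec {M : Set ModalFormula} (hM : MCS M) {a : ModalFormula} (ha : box a ∉ M) :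
    MCS (next M a) ∧ (∀ c, box c ∈ M → c ∈ next M a ∧ box c ∈ next M a) ∧
      box a ∈ next M a ∧ a ∉ next M a := by
  have h : MCS M ∧ box a ∉ M := ⟨hM, ha⟩
  rw [next, dif_pos h]
  exact Classical.choose_spec (exists_next h.1 h.2)

/-- The maximal consistent set at the end of a path. -/
noncomputable def state (M : Set ModalFormula) : List ModalFormula → Set ModalFormula
  | [] => M
  | a :: l => next (state M l) a

/-- Paths in the tree. -/
def Good (S M : Set ModalFormula) : List ModalFormula → Prop
  | [] => True
  | a :: l => Good S M l ∧ box a ∈ S ∧ box a ∉ state M l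

/-- Subformulas. -/
def sub : ModalFormula → Set ModalFormula
  | var n => {var n}
  | bot => {bot}
  | imp a b => insert (imp a b) (sub a ∪ sub b)
  | box a => insert (box a) (sub a)

theorem sub_finite (a : ModalFormula) : (sub a).Finite := by
  induction a with
  | var n => exact Set.finite_singleton _
  | bot => exact Set.finite_singleton _
  | imp a b h1 h2 => exact (h1.union h2).insert _
  | box a h => exact h.insert _

theorem sub_self (a : ModalFormula) : a ∈ sub a := by
  cases a <;> simp [sub]

theorem sub_imp (p a b : ModalFormula) (h : imp a b ∈ sub p) : a ∈ sub p ∧ b ∈ sub p := by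
  induction p with
  | var n => simp [sub] at h
  | bot => simp [sub] at h
  | imp c d h1 h2 =>
    simp only [sub, Set.mem_insert_iff, Set.mem_union, imp.injEq] at h ⊢
    rcases h with ⟨rfl, rfl⟩ | h | h
    · exact ⟨.inr (.inl (sub_self _)), .inr (.inr (sub_self _))⟩
    · exact ⟨.inr (.inl (h1 h).1), .inr (.inl (h1 h).2)⟩
    · exact ⟨.inr (.inr (h2 h).1), .inr (.inr (h2 h).2)⟩
  | box c h1 =>
    simp only [sub, Set.mem_insert_iff, reduceCtorEq, false_or] at h ⊢
    exact ⟨.inr (h1 h).1, .inr (h1 h).2⟩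

theorem sub_box (p a : ModalFormula) (h : box a ∈ sub p) : a ∈ sub p := by
  induction p with
  | var n => simp [sub] at h
  | bot => simp [sub] at h
  | imp c d h1 h2 =>
    simp only [sub, Set.mem_insert_iff, Set.mem_union, reduceCtorEq, false_or] at h ⊢
    rcases h with h | h
    · exact .inr (.inl (h1 h))
    · exact .inr (.inr (h2 h))
  | box c h1 =>
    simp only [sub, Set.mem_insert_iff, box.injEq] at h ⊢
    rcases h with rfl | h
    · exact .inr (sub_self _)
    · exact .inr (h1 h)

theorem good_mcs {S M : Set ModalFormula} (hM : MCS M) (l : List ModalFormula)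
    (hl : Good S M l) : MCS (state M l) := by
  induction l with
  | nil => exact hM
  | cons a l ih => exact (next_spec (ih hl.1) hl.2.2).1

theorem good_box {S M : Set ModalFormula} (hM : MCS M) (l m : List ModalFormula)
    (hm : Good S M (m ++ l)) (a : ModalFormula) (ha : box a ∈ state M l) :
    box a ∈ state M (m ++ l) ∧ (m ≠ [] → a ∈ state M (m ++ l)) := by
  induction m with
  | nil => exact ⟨ha, fun h => absurd rfl h⟩
  | cons b m ih =>
    have h1 := (ih hm.1).1
    have h2 := (next_spec (good_mcs hM _ hm.1) hm.2.2).2.1 a h1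
    exact ⟨h2.2, fun _ => h2.1⟩

theorem good_mem {S M : Set ModalFormula} (hM : MCS M) (l : List ModalFormula)
    (hl : Good S M l) : l.Nodup ∧ ∀ a ∈ l, box a ∈ S ∧ box a ∈ state M l := by
  induction l with
  | nil => simp
  | cons b l ih =>
    have h := ih hl.1
    have h2 := next_spec (good_mcs hM _ hl.1) hl.2.2
    refine ⟨List.nodup_cons.2 ⟨fun hb => hl.2.2 (h.2 b hb).2, h.1⟩, ?_⟩
    intro a ha
    rcases List.mem_cons.1 ha with rfl | ha
    · exact ⟨hl.2.1, h2.2.2.1⟩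
    · exact ⟨(h.2 a ha).1, (h2.2.1 a (h.2 a ha).2).2⟩

theorem good_finite {S M : Set ModalFormula} (hS : S.Finite) (hM : MCS M) :
    {l | Good S M l}.Finite := by
  classical
  have hT : {a | box a ∈ S}.Finite :=
    hS.preimage (f := box) (fun a _ b _ h => by injection h)
  have : Finite {a | box a ∈ S} := hT
  have hf : Finite {l : List {a | box a ∈ S} // l.Nodup} := by
    have := Fintype.ofFinite {a | box a ∈ S}
    infer_instance
  refine (Set.finite_range
    (fun l : {l : List {a | box a ∈ S} // l.Nodup} => l.1.map Subtype.val)).subset ?_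
  intro l hl
  have h := good_mem hM l hl
  have hmem : ∀ a ∈ l, a ∈ {a | box a ∈ S} := fun a ha => (h.2 a ha).1
  lift l to List {a | box a ∈ S} using hmem
  exact ⟨⟨l, h.1.of_map _⟩, rfl⟩

theorem good_suffix {S M : Set ModalFormula} (l m : List ModalFormula)
    (hm : Good S M (m ++ l)) : Good S M l := by
  induction m with
  | nil => exact hm
  | cons b m ih => exact ih hm.1

end GLC

/-- Segerberg's completeness theorem: a formula valid in every finite transitive
irreflexive tree is provable in GL. -/
theorem GL_complete_finite_trees (φ : ModalFormula)
    (h : ∀ (W : Type) (R : W → W → Prop), IsFTITree R →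
      ∀ (v : ℕ → Set W) (w : W), w ∈ ksat R v φ) :
    GLProof φ := by
  by_contra hnp
  have hnd : ¬ GLC.Der ∅ φ := by
    intro hd
    apply hnp
    clear hnp h
    induction hd with
    | hyp h => exact absurd h (Set.notMem_empty _)
    | thm h => exact h
    | mp _ _ h1 h2 => exact .mp h1 h2
  obtain ⟨M, -, hM, hφ⟩ := GLC.lindenbaum hnd
  let W := {l : List ModalFormula // GLC.Good (GLC.sub φ) M l}
  let R : W → W → Prop := fun l m => ∃ k, k ≠ [] ∧ m.1 = k ++ l.1
  let v : ℕ → Set W := fun n => {l | ModalFormula.var n ∈ GLC.state M l.1}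
  have hR : IsFTITree R := by
    refine ⟨GLC.good_finite (GLC.sub_finite φ) hM, ?_, ?_, ⟨⟨[], trivial⟩, ?_⟩, ?_⟩
    · rintro a b c ⟨k, hk, hb⟩ ⟨k', hk', hc⟩
      exact ⟨k' ++ k, by simp [hk], by rw [hc, hb, List.append_assoc]⟩
    · rintro a ⟨k, hk, ha⟩
      exact hk (List.self_eq_append_left.1 ha)
    · intro w hw
      exact ⟨w.1, fun h0 => hw (Subtype.ext h0), by simp⟩
    · rintro w a b ⟨k, hk, ha⟩ ⟨k', hk', hb⟩
      have hs : ∀ x y : W, x.1 <:+ y.1 → x = y ∨ R x y := by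
        rintro x y ⟨t, ht⟩
        by_cases h0 : t = []
        · subst h0
          exact Or.inl (Subtype.ext ht)
        · exact Or.inr ⟨t, h0, ht.symm⟩
      rcases List.suffix_or_suffix_of_suffix (⟨k, ha.symm⟩ : a.1 <:+ w.1) ⟨k', hb.symm⟩ with h1 | h1
      · rcases hs _ _ h1 with h2 | h2
        · exact Or.inl h2
        · exact Or.inr (Or.inl h2)
      · rcases hs _ _ h1 with h2 | h2
        · exact Or.inl h2.symm
        · exact Or.inr (Or.inr h2)
  have truth : ∀ ψ, ψ ∈ GLC.sub φ → ∀ w : W, w ∈ ksat R v ψ ↔ ψ ∈ GLC.state M w.1 := by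
    intro ψ
    induction ψ with
    | var n => intro _ w; exact Iff.rfl
    | bot => intro _ w; exact iff_of_false (Set.notMem_empty _) (GLC.good_mcs hM _ w.2).nbot
    | imp a b h1 h2 =>
      intro hs w
      have hs' := GLC.sub_imp _ _ _ hs
      rw [(GLC.good_mcs hM _ w.2).imp_iff, ← h1 hs'.1, ← h2 hs'.2]
      exact Iff.rfl
    | box a h1 =>
      intro hs w
      have hs' := GLC.sub_box _ _ hs
      constructor
      · intro hw
        by_contra hcon
        have hx := hw ⟨a :: w.1, w.2, hs, hcon⟩ ⟨[a], by simp, rfl⟩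
        rw [h1 hs'] at hx
        exact (GLC.next_spec (GLC.good_mcs hM _ w.2) hcon).2.2.2 hx
      · rintro hw ⟨x, hx⟩ ⟨k, hk, hxk⟩
        rw [h1 hs']
        simp only at hxk
        subst hxk
        exact (GLC.good_box hM _ _ hx a hw).2 hk
  have := h W R hR v ⟨[], trivial⟩
  rw [truth φ (GLC.sub_self φ)] at this
  exact hφ this
end

section
/- For every natural number n, every finite transitive irreflexive tree (W,R) of height exactly n is a bounded morphic image of the tree K_n ordered by strict end-extension: there is a surjection f from the nodes of K_n onto W such that s ⊲ t implies f(s) R f(t), and whenever f(s) R w there is t with s ⊲ t and f(t) = w. -/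
/-- Nodes of Blass's tree `K n`: finite sequences `⟨(i₁,j₁),…,(i_k,j_k)⟩` of pairs of
natural numbers with `n > i₁ > … > i_k ≥ 0` and the `j`'s arbitrary. -/
def KNode (n : ℕ) : Type :=
  {l : List (ℕ × ℕ) // (l.map Prod.fst).Chain' (· > ·) ∧ ∀ p ∈ l, p.1 < n}

/-- The order of `K n`: strict end-extension. -/
def KLt {n : ℕ} (s t : KNode n) : Prop :=
  s.val <+: t.val ∧ s.val ≠ t.val

/-- `(W, R)` has an `R`-chain `w₀ R w₁ R … R w_k`. -/
def HasRChain {W : Type} (R : W → W → Prop) (k : ℕ) : Prop :=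
  ∃ w : ℕ → W, ∀ i < k, R (w i) (w (i + 1))

/-- There is a chain of length `k` starting at `u`. -/
def ChainFrom {W : Type} (R : W → W → Prop) : ℕ → W → Prop
  | 0, _ => True
  | k + 1, u => ∃ v, R u v ∧ ChainFrom R k v

theorem chainFrom_pred {W : Type} (R : W → W → Prop) (k : ℕ) :
    ∀ u, ChainFrom R (k + 1) u → ChainFrom R k u := by
  induction k with
  | zero => intro u _; trivial
  | succ k ih =>
    rintro u ⟨v, huv, hv⟩
    exact ⟨v, huv, ih v hv⟩

theorem chainFrom_mono {W : Type} (R : W → W → Prop) {k m : ℕ} (h : k ≤ m) (u : W)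
    (hm : ChainFrom R m u) : ChainFrom R k u := by
  induction m, h using Nat.le_induction with
  | base => exact hm
  | succ m _ ih => exact ih (chainFrom_pred R m u hm)

theorem chainFrom_exists {W : Type} (R : W → W → Prop) (k : ℕ) :
    ∀ u, ChainFrom R k u → ∃ w : ℕ → W, w 0 = u ∧ ∀ i < k, R (w i) (w (i + 1)) := by
  induction k with
  | zero => intro u _; exact ⟨fun _ => u, rfl, by simp⟩
  | succ k ih =>
    rintro u ⟨v, huv, hv⟩
    obtain ⟨w, hw0, hw⟩ := ih v hv
    refine ⟨fun i => Nat.casesOn i u w, rfl, ?_⟩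
    intro i hi
    cases i with
    | zero => simpa [hw0] using huv
    | succ i => exact hw i (by omega)

theorem chainFrom_of_chain {W : Type} (R : W → W → Prop) (k : ℕ) :
    ∀ w : ℕ → W, (∀ i < k, R (w i) (w (i + 1))) → ChainFrom R k (w 0) := by
  induction k with
  | zero => intro w _; trivial
  | succ k ih =>
    intro w hw
    exact ⟨w 1, hw 0 (by omega), ih (fun i => w (i + 1)) (fun i hi => hw (i + 1) (by omega))⟩

theorem exists_rank {W : Type} (R : W → W → Prop) (n : ℕ) (htr : Transitive R)
    (hn : ¬ HasRChain R (n + 1)) :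
    ∃ rk : W → ℕ, (∀ k u, ChainFrom R k u ↔ k ≤ rk u) ∧ (∀ u, rk u ≤ n) ∧
      (∀ u v, R u v → rk v < rk u) ∧
      (∀ u i, i < rk u → ∃ v, R u v ∧ rk v = i) := by
  classical
  have hC : ∀ k u, ChainFrom R k u → k ≤ n := by
    intro k u h
    by_contra hk
    obtain ⟨w, _, hw⟩ := chainFrom_exists R (n + 1) u (chainFrom_mono R (by omega) u h)
    exact hn ⟨w, hw⟩
  let rk : W → ℕ := fun u => Nat.findGreatest (fun k => ChainFrom R k u) n
  have h1 : ∀ k u, ChainFrom R k u ↔ k ≤ rk u := by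
    intro k u
    constructor
    · intro h
      exact Nat.le_findGreatest (hC k u h) h
    · intro h
      refine chainFrom_mono R h u ?_
      exact Nat.findGreatest_spec (P := fun k => ChainFrom R k u) (Nat.zero_le n) trivial
  have h3 : ∀ u v, R u v → rk v < rk u := by
    intro u v huv
    exact (h1 (rk v + 1) u).1 ⟨v, huv, (h1 _ _).2 le_rfl⟩
  refine ⟨rk, h1, fun u => Nat.findGreatest_le n, h3, ?_⟩
  have key : ∀ k u, rk u = k → ∀ i < k, ∃ v, R u v ∧ rk v = i := by
    intro k
    induction k with
    | zero => intro u _ i hi; omega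
    | succ k ih =>
      intro u hu i hi
      obtain ⟨v, huv, hv⟩ := (h1 (k + 1) u).2 hu.ge
      have ha := (h1 k v).1 hv
      have hb := h3 u v huv
      have hvk : rk v = k := by omega
      rcases Nat.lt_or_ge i k with h | h
      · obtain ⟨x, hx, hxi⟩ := ih v hvk i h
        exact ⟨x, htr huv hx, hxi⟩
      · exact ⟨v, huv, by omega⟩
  intro u i hi
  exact key _ u rfl i hi

theorem exists_step {W : Type} (R : W → W → Prop) (hfin : Finite W) (rk : W → ℕ)
    (h : ∀ u i, i < rk u → ∃ v, R u v ∧ rk v = i) :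
    ∃ g : W → ℕ → ℕ → W, ∀ u i, i < rk u →
      (∀ j, R u (g u i j) ∧ rk (g u i j) = i) ∧
      (∀ v, R u v → rk v = i → ∃ j, g u i j = v) := by
  have : ∀ u i, ∃ g : ℕ → W, i < rk u →
      (∀ j, R u (g j) ∧ rk (g j) = i) ∧ (∀ v, R u v → rk v = i → ∃ j, g j = v) := by
    intro u i
    by_cases hi : i < rk u
    · obtain ⟨v, hv⟩ := h u i hi
      haveI : Nonempty {v // R u v ∧ rk v = i} := ⟨⟨v, hv⟩⟩
      obtain ⟨e, he⟩ := exists_surjective_nat {v // R u v ∧ rk v = i}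
      refine ⟨fun j => (e j).1, fun _ => ⟨fun j => (e j).2, ?_⟩⟩
      intro x hx hxi
      obtain ⟨j, hj⟩ := he ⟨x, hx, hxi⟩
      exact ⟨j, by simp [hj]⟩
    · exact ⟨fun _ => u, fun hh => absurd hh hi⟩
  choose g hg using this
  exact ⟨g, hg⟩

theorem fold_props {W : Type} (R : W → W → Prop) (htr : Transitive R) (rk : W → ℕ)
    (g : W → ℕ → ℕ → W)
    (hg : ∀ u i, i < rk u → ∀ j, R u (g u i j) ∧ rk (g u i j) = i)
    (l : List (ℕ × ℕ)) :
    ∀ w, l.Pairwise (fun p q => p.1 > q.1) → (∀ p ∈ l, p.1 < rk w) →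
      (l ≠ [] → R w (l.foldl (fun u p => g u p.1 p.2) w)) ∧
      (∀ p ∈ l, rk (l.foldl (fun u p => g u p.1 p.2) w) ≤ p.1) ∧
      (∀ i, (∀ p ∈ l, i < p.1) → i < rk w →
        i < rk (l.foldl (fun u p => g u p.1 p.2) w)) := by
  induction l with
  | nil => intro w _ _; simp
  | cons p l ih =>
    intro w hp hl
    rw [List.pairwise_cons] at hp
    have hpw := hg w p.1 (hl p (by simp)) p.2
    obtain ⟨a, b, c⟩ := ih (g w p.1 p.2) hp.2 (fun q hq => by rw [hpw.2]; exact hp.1 q hq)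
    simp only [List.foldl_cons]
    have hle : rk (l.foldl (fun u p => g u p.1 p.2) (g w p.1 p.2)) ≤ p.1 := by
      rcases l with _ | ⟨q, l⟩
      · simp [hpw.2]
      · exact (b q (by simp)).trans (hp.1 q (by simp)).le
    refine ⟨fun _ => ?_, ?_, ?_⟩
    · by_cases hnil : l = []
      · subst hnil; exact hpw.1
      · exact htr hpw.1 (a hnil)
    · intro q hq
      rcases List.mem_cons.1 hq with rfl | hq
      · exact hle
      · exact b q hq
    · intro i hi _
      exact c i (fun q hq => hi q (by simp [hq])) (by rw [hpw.2]; exact hi p (by simp))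

theorem knode_iff (l : List (ℕ × ℕ)) :
    (l.map Prod.fst).Chain' (· > ·) ↔ l.Pairwise (fun p q => p.1 > q.1) := by
  unfold List.Chain'
  rw [List.isChain_iff_pairwise, List.pairwise_map]

/-- Every finite transitive irreflexive tree of height exactly `n` is a bounded morphic
image of `K n`. -/
theorem tree_is_bounded_morphic_image_of_Kn (n : ℕ) (W : Type) (R : W → W → Prop)
    (htree : IsFTITree R) (hheight : HasRChain R n ∧ ¬ HasRChain R (n + 1)) :
    ∃ f : KNode n → W, Function.Surjective f ∧
      (∀ s t : KNode n, KLt s t → R (f s) (f t)) ∧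
      (∀ (s : KNode n) (w : W), R (f s) w → ∃ t : KNode n, KLt s t ∧ f t = w) := by
  classical
  obtain ⟨hfin, htr, hirr, ⟨r, hr⟩, -⟩ := htree
  obtain ⟨⟨w0, hw0⟩, hn⟩ := hheight
  obtain ⟨rk, h1, h2, h3, h4⟩ := exists_rank R n htr hn
  obtain ⟨g, hg⟩ := exists_step R hfin rk h4
  have hrk : rk r = n := by
    have hc := (h1 _ _).1 (chainFrom_of_chain R n w0 hw0)
    have := h2 r
    by_cases h : w0 0 = r
    · rw [h] at hc; omega
    · have := h3 _ _ (hr _ h); omega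
  have hF := fold_props R htr rk g (fun u i hi => (hg u i hi).1)
  let f : KNode n → W := fun s => s.val.foldl (fun u p => g u p.1 p.2) r
  have back : ∀ (s : KNode n) (w : W), R (f s) w → ∃ t : KNode n, KLt s t ∧ f t = w := by
    rintro ⟨l, hl, hln⟩ w hw
    have hl' := (knode_iff l).1 hl
    obtain ⟨-, hb, -⟩ := hF l r hl' (by rw [hrk]; exact hln)
    have hlt := h3 _ _ hw
    obtain ⟨j, hj⟩ := (hg _ _ hlt).2 w hw rfl
    refine ⟨⟨l ++ [(rk w, j)], ?_, ?_⟩, ⟨?_, ?_⟩, ?_⟩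
    · rw [knode_iff, List.pairwise_append]
      refine ⟨hl', by simp, ?_⟩
      intro p hp q hq
      rw [List.mem_singleton] at hq
      subst hq
      exact lt_of_lt_of_le hlt (hb p hp)
    · intro p hp
      rcases List.mem_append.1 hp with hp | hp
      · exact hln p hp
      · rw [List.mem_singleton] at hp
        subst hp
        exact lt_of_lt_of_le hlt (h2 _)
    · exact List.prefix_append _ _
    · simp
    · simpa [f] using hj
  refine ⟨f, ?_, ?_, back⟩
  · intro w
    let s0 : KNode n := ⟨[], by rw [knode_iff]; simp, by simp⟩
    have hs0 : f s0 = r := rfl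
    by_cases h : w = r
    · exact ⟨s0, by rw [hs0, h]⟩
    · obtain ⟨t, -, ht⟩ := back s0 w (by rw [hs0]; exact hr w h)
      exact ⟨t, ht⟩
  · rintro ⟨l, hl, hln⟩ ⟨m, hm, hmn⟩ ⟨⟨u, hu⟩, hne⟩
    simp only at hu hne
    subst hu
    have hm' := (knode_iff _).1 hm
    rw [List.pairwise_append] at hm'
    obtain ⟨hl', hu', hlu⟩ := hm'
    obtain ⟨-, -, hc⟩ := hF l r hl' (by rw [hrk]; exact hln)
    have := (hF u (l.foldl (fun u p => g u p.1 p.2) r) hu' (fun p hp =>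
      hc p.1 (fun q hq => hlu q hq p hp) (by rw [hrk]; exact hmn p (by simp [hp])))).1
      (by rintro rfl; simp at hne)
    simpa [f, List.foldl_append] using this
end
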